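/- arXiv:0708.1980 — 4 statements merged into one kernel-verified Lean document; each statement's English description precedes it below -/
import Mathlib

section
/- (Singular compactness for abelian groups) If λ is a singular cardinal and G is an abelian group of cardinality λ such that every subgroup of G of cardinality less than λ is free, then G is free. -/
universe u

/-- An abelian group is free if it is a free `ℤ`-module. -/
def IsFreeAbelian (G : Type u) [AddCommGroup G] : Prop :=
  Module.Free ℤ G

/-- `G` is `κ`-free: every subgroup of cardinality `< κ` is free. -/
def IsKappaFree (κ : Cardinal.{u}) (G : Type u) [AddCommGroup G] : Prop :=
  ∀ H : AddSubgroup G, Cardinal.mk H < κ → IsFreeAbelian H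

/-- `G` is a Whitehead group. -/
def IsWhitehead (G : Type u) [AddCommGroup G] : Prop :=
  ∀ (H : Type u) [AddCommGroup H] (π : H →+ G),
    Function.Surjective π → Nonempty (π.ker ≃+ ℤ) →
      ∃ s : G →+ H, π.comp s = AddMonoidHom.id G

/-- strongly κ-free -/
def IsStronglyKappaFree (κ : Cardinal.{u}) (G : Type u) [AddCommGroup G] : Prop :=
  IsKappaFree κ G ∧
    ∀ H : AddSubgroup G, Cardinal.mk H < κ →
      ∃ K : AddSubgroup G, H ≤ K ∧ Cardinal.mk K < κ ∧ IsKappaFree κ (G ⧸ K)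

namespace Submodule

section Ring

variable {R M : Type*} [Ring R] [AddCommGroup M] [Module R M]

/-- `A` is contained in `B` and has a free complement in `B`. -/
def HasFreeComplIn (A B : Submodule R M) : Prop :=
  ∃ C : Submodule R M, Module.Free R C ∧ Disjoint A C ∧ A ⊔ C = B

theorem iSupIndep_of_disjoint_iSup_lt {ι : Type*} [LinearOrder ι] {C : ι → Submodule R M}
    (hC : ∀ i, Disjoint (⨆ j < i, C j) (C i)) : iSupIndep C := by
  classical
  apply iSupIndep_of_dfinsupp_lsum_injective
  rw [← LinearMap.ker_eq_bot, LinearMap.ker_eq_bot']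
  intro f hf
  by_contra hne
  have hs : f.support.Nonempty := by
    rwa [Finset.nonempty_iff_ne_empty, ne_eq, DFinsupp.support_eq_empty]
  set i := f.support.max' hs
  have hi : i ∈ f.support := f.support.max'_mem hs
  rw [DFinsupp.lsum_apply_apply, DFinsupp.sumAddHom_apply, DFinsupp.sum,
    ← Finset.sum_erase_add _ _ hi] at hf
  have hlt : ∑ j ∈ f.support.erase i, ((f j : C j) : M) ∈ ⨆ j < i, C j := by
    refine sum_mem fun j hj ↦ ?_
    have hji : j < i := f.support.lt_max'_of_mem_erase_max' hs hj
    exact mem_iSup_of_mem j (mem_iSup_of_mem hji (f j).2)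
  have hmem : (f i : M) ∈ ⨆ j < i, C j := by
    rw [← neg_mem_iff]
    convert hlt using 1
    exact (eq_neg_of_add_eq_zero_left hf).symm
  exact (DFinsupp.mem_support_iff.1 hi)
    (Subtype.ext (disjoint_def.1 (hC i) _ hmem (f i).2))

theorem free_of_hasFreeComplIn_iSup_lt {ι : Type*} [LinearOrder ι] [WellFoundedLT ι]
    {A : ι → Submodule R M} (hA : ∀ i, HasFreeComplIn (⨆ j < i, A j) (A i))
    (htop : ⨆ i, A i = ⊤) : Module.Free R M := by
  classical
  choose C hfree hdisj hsup using hA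
  have hCA (i) : C i ≤ A i := hsup i ▸ le_sup_right
  have hAC (i) : A i ≤ ⨆ j, C j := by
    induction i using WellFoundedLT.induction with
    | ind i ih =>
      rw [← hsup i]
      exact sup_le (iSup₂_le ih) (le_iSup C i)
  have hind : iSupIndep C := iSupIndep_of_disjoint_iSup_lt fun i ↦
    (hdisj i).mono_left (iSup₂_mono fun j _ ↦ hCA j)
  have hint := DirectSum.isInternal_submodule_of_iSupIndep_of_iSup_eq_top hind
    (top_le_iff.1 (htop ▸ iSup_le hAC))
  exact .of_basis (hint.collectedBasis fun i ↦ Module.Free.chooseBasis R (C i))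

theorem hasFreeComplIn_map_ker {P : Type*} [AddCommGroup P] [Module R P] [Module.Free R P]
    {B : Submodule R M} (f : B →ₗ[R] P) (hf : Function.Surjective f) :
    HasFreeComplIn (map B.subtype (LinearMap.ker f)) B := by
  obtain ⟨s, hs⟩ := Module.projective_lifting_property f LinearMap.id hf
  have hs' (p) : f (s p) = p := LinearMap.congr_fun hs p
  have hinj : Function.Injective (B.subtype ∘ₗ s) := by
    rw [LinearMap.coe_comp]
    exact B.injective_subtype.comp (Function.LeftInverse.injective hs')
  refine ⟨LinearMap.range (B.subtype ∘ₗ s), .of_equiv (LinearEquiv.ofInjective _ hinj), ?_, ?_⟩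
  · rw [disjoint_def]
    rintro _ ⟨y, hy, rfl⟩ ⟨p, hp⟩
    obtain rfl : s p = y := B.injective_subtype hp
    have : p = 0 := by rw [← hs' p]; exact hy
    simp [this]
  · apply le_antisymm
    · refine sup_le (map_subtype_le _ _) ?_
      rintro _ ⟨p, rfl⟩
      exact (s p).2
    · intro x hx
      refine mem_sup.2 ⟨_, ⟨⟨x, hx⟩ - s (f ⟨x, hx⟩), ?_, rfl⟩, _, ⟨f ⟨x, hx⟩, rfl⟩, ?_⟩
      · simp [hs']
      · simp

end Ring

theorem free_of_free {R M : Type*} [CommRing R] [IsDomain R] [IsPrincipalIdealRing R]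
    [AddCommGroup M] [Module R M] [Module.Free R M] (N : Submodule R M) : Module.Free R N := by
  obtain ⟨_, _⟩ := exists_wellFoundedLT (Module.Free.ChooseBasisIndex R M)
  let b := Module.Free.chooseBasis R M
  let A (i : Module.Free.ChooseBasisIndex R M) : Submodule R N :=
    ⨅ k > i, LinearMap.ker (b.coord k ∘ₗ N.subtype)
  have hA {i} {x : N} : x ∈ A i ↔ ∀ k > i, b.repr x k = 0 := by simp [A]
  have hlt {i} {x : N} (hx : ∀ k ≥ i, b.repr x k = 0) : x ∈ ⨆ j < i, A j := by
    rcases (b.repr x).support.eq_empty_or_nonempty with h | h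
    · have : x = 0 := by simpa using h
      simp [this]
    · have hm := (b.repr x).support.max'_mem h
      suffices (b.repr x).support.max' h < i ∧ x ∈ A ((b.repr x).support.max' h) from
        mem_iSup_of_mem _ (mem_iSup_of_mem this.1 this.2)
      constructor
      · contrapose! hm
        simpa using hx _ hm
      · rw [hA]
        intro k hk
        contrapose! hk
        exact Finset.le_max' _ _ (by simpa using hk)
  refine free_of_hasFreeComplIn_iSup_lt (A := A) (fun i ↦ ?_) ?_
  · let f := (b.coord i ∘ₗ N.subtype ∘ₗ (A i).subtype).rangeRestrict
    have := hasFreeComplIn_map_ker f (LinearMap.surjective_rangeRestrict _)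
    convert this using 1
    apply le_antisymm
    · refine iSup₂_le fun j hj x hx ↦ ?_
      rw [hA] at hx
      refine ⟨⟨x, hA.2 fun k hk ↦ hx k (hj.trans hk)⟩, ?_, rfl⟩
      simpa [f] using hx i hj
    · rintro _ ⟨x, hx, rfl⟩
      refine hlt fun k hk ↦ ?_
      rcases hk.eq_or_lt with rfl | hk
      · simpa [f] using hx
      · exact hA.1 x.2 k hk
  · refine eq_top_iff.2 fun x _ ↦ ?_
    rcases (b.repr x).support.eq_empty_or_nonempty with h | h
    · have : x = 0 := by simpa using h
      simp [this]
    · refine mem_iSup_of_mem ((b.repr x).support.max' h) (hA.2 fun k hk ↦ ?_)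
      contrapose! hk
      exact Finset.le_max' _ _ (by simpa using hk)

section Ring

variable {R M : Type*} [Ring R] [AddCommGroup M] [Module R M]

theorem exists_linearIndepOn_span_eq (A : Submodule R M) [Module.Free R A] :
    ∃ X : Set M, LinearIndepOn R id X ∧ span R X = A := by
  let b := Module.Free.chooseBasis R A
  refine ⟨Set.range (A.subtype ∘ b), ?_, ?_⟩
  · exact (b.linearIndependent.map' A.subtype A.ker_subtype).linearIndepOn_id
  · rw [Set.range_comp, span_image, b.span_eq, map_top, range_subtype]

theorem free_span {X : Set M} (hX : LinearIndepOn R id X) : Module.Free R (span R X) := by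
  have h : Module.Free R (span R (Set.range ((↑) : X → M))) :=
    .of_basis (Module.Basis.span hX.linearIndependent)
  rwa [Subtype.range_coe] at h

theorem hasFreeComplIn_span {X Y : Set M} (hX : LinearIndepOn R id X) (hY : Y ⊆ X) :
    HasFreeComplIn (span R Y) (span R X) := by
  refine ⟨span R (X \ Y), free_span (hX.mono Set.sdiff_subset), ?_, ?_⟩
  · have hX' : LinearIndependent R ((↑) : X → M) := hX.linearIndependent
    have := hX'.disjoint_span_image (s := (↑) ⁻¹' Y) (t := (↑) ⁻¹' (X \ Y))
      (Disjoint.preimage _ Set.disjoint_sdiff_right)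
    simpa [Subtype.image_preimage_coe, Set.inter_eq_self_of_subset_right hY,
      Set.inter_eq_self_of_subset_right Set.sdiff_subset] using this
  · rw [← span_union, Set.union_sdiff_cancel hY]

theorem HasFreeComplIn.exists_linearIndepOn {A B : Submodule R M} (h : HasFreeComplIn A B)
    {X : Set M} (hX : LinearIndepOn R id X) (hXA : span R X = A) :
    ∃ Y, X ⊆ Y ∧ LinearIndepOn R id Y ∧ span R Y = B := by
  obtain ⟨C, _, hdisj, rfl⟩ := h
  obtain ⟨Z, hZ, rfl⟩ := C.exists_linearIndepOn_span_eq
  subst hXA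
  exact ⟨X ∪ Z, Set.subset_union_left, hX.id_union hZ hdisj, span_union X Z⟩

end Ring

theorem HasFreeComplIn.of_le {R M : Type*} [CommRing R] [IsDomain R] [IsPrincipalIdealRing R]
    [AddCommGroup M] [Module R M] {A B C : Submodule R M} (h : HasFreeComplIn A B) (hAC : A ≤ C)
    (hCB : C ≤ B) : HasFreeComplIn A C := by
  obtain ⟨D, _, hdisj, rfl⟩ := h
  refine ⟨D ⊓ C, ?_, hdisj.mono_right inf_le_left, ?_⟩
  · exact (free_of_free (comap D.subtype C)).of_equiv
      ((equivMapOfInjective _ D.injective_subtype _).trans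
        (LinearEquiv.ofEq _ _ (map_comap_subtype D C)))
  · rw [← sup_inf_assoc_of_le _ hAC, inf_eq_right.2 hCB]

end Submodule

open Cardinal

theorem Cardinal.mk_iUnion_le_of_forall {α ι : Type u} {κ : Cardinal.{u}} (hκ : ℵ₀ ≤ κ)
    {s : ι → Set α} (hι : #ι ≤ κ) (hs : ∀ i, #(s i) ≤ κ) : #(⋃ i, s i) ≤ κ :=
  (mk_iUnion_le s).trans (mul_le_of_le hκ hι (ciSup_le' hs))

theorem Cardinal.mk_union_le_of_le {α : Type u} {κ : Cardinal.{u}} (hκ : ℵ₀ ≤ κ)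
    {s t : Set α} (hs : #s ≤ κ) (ht : #t ≤ κ) : #(s ∪ t : Set α) ≤ κ :=
  (mk_union_le s t).trans (add_le_of_le hκ hs ht)

theorem Submodule.exists_subset_subset_span {R : Type*} {M : Type u} [Ring R] [AddCommGroup M]
    [Module R M] {κ : Cardinal.{u}} (hκ : ℵ₀ ≤ κ) {X S : Set M} (hSX : S ⊆ span R X) (hS : #S ≤ κ) :
    ∃ T ⊆ X, #T ≤ κ ∧ S ⊆ span R T := by
  choose! F hFX hF using fun x (hx : x ∈ S) ↦ mem_span_finite_of_mem_span (hSX hx)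
  refine ⟨⋃ x : S, F x, Set.iUnion_subset fun x ↦ hFX x x.2, ?_, fun x hx ↦ ?_⟩
  · exact mk_iUnion_le_of_forall hκ hS fun x ↦
      (Cardinal.lt_aleph0_of_finite _).le.trans hκ
  · exact span_mono (Set.subset_iUnion (fun x : S ↦ (F x : Set M)) ⟨x, hx⟩) (hF x hx)

section

variable {G : Type u} [AddCommGroup G]

theorem Submodule.mk_span_int_le {κ : Cardinal.{u}} (hκ : ℵ₀ ≤ κ) {s : Set G} (hs : #s ≤ κ) :
    #(span ℤ s) ≤ κ := by
  rcases s.eq_empty_or_nonempty with rfl | hne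
  · simpa using one_le_aleph0.trans hκ
  · have := hne.to_subtype
    have h : span ℤ s = (Finsupp.linearCombination ℤ ((↑) : s → G)).range := by
      rw [Finsupp.range_linearCombination, Subtype.range_coe]
    rw [h]
    refine mk_range_le.trans ?_
    rw [mk_finsupp_lift_of_infinite']
    simpa using ⟨hs, hκ⟩

namespace Submodule

/-- Every submodule of cardinality at most `κ` containing `B` splits freely over `B`. -/
def IsFreelySplit (κ : Cardinal.{u}) (B : Submodule ℤ G) : Prop :=
  ∀ C : Submodule ℤ G, B ≤ C → #C ≤ κ → HasFreeComplIn B C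

theorem mk_iSup_int_le {κ : Cardinal.{u}} (hκ : ℵ₀ ≤ κ) {ι : Type u} {A : ι → Submodule ℤ G}
    (hι : #ι ≤ κ) (hA : ∀ i, #(A i) ≤ κ) : #(⨆ i, A i : Submodule ℤ G) ≤ κ := by
  rw [iSup_eq_span]
  exact mk_span_int_le hκ (mk_iUnion_le_of_forall hκ hι hA)

theorem mk_sup_int_le {κ : Cardinal.{u}} (hκ : ℵ₀ ≤ κ) {A B : Submodule ℤ G}
    (hA : #A ≤ κ) (hB : #B ≤ κ) : #(A ⊔ B : Submodule ℤ G) ≤ κ := by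
  rw [← A.span_eq, ← B.span_eq, ← span_union]
  exact mk_span_int_le hκ (mk_union_le_of_le hκ hA hB)

theorem exists_span_eq_of_continuous_chain {κ : Cardinal.{u}} (hκ : ℵ₀ ≤ κ)
    {I : Type u} [LinearOrder I] [WellFoundedLT I] [Nonempty I]
    (hI : ∀ s : Set I, #s ≤ κ → ∃ i, ∀ j ∈ s, j < i)
    {B : I → Submodule ℤ G} (hmono : Monotone B) (hcard : ∀ i, #(B i) ≤ κ)
    (hcont : ∀ i, (∀ j < i, ∃ k < i, j < k) → (∃ j, j < i) → B i = ⨆ j < i, B j)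
    {X : Set G} (hX : span ℤ X = ⨆ i, B i) : ∃ i, ∃ Y ⊆ X, span ℤ Y = B i := by
  have hstep (i : I) : ∃ k > i, ∃ T ⊆ X, B i ≤ span ℤ T ∧ T ⊆ B k := by
    obtain ⟨T, hTX, hT, hBT⟩ := exists_subset_subset_span hκ (R := ℤ) (X := X) (S := B i)
      (hX ▸ le_iSup B i) (hcard i)
    have hmem (t : T) : ∃ j, (t : G) ∈ B j := by
      rw [← mem_iSup_of_directed _ hmono.directed_le, ← hX]
      exact subset_span (hTX t.2)
    choose j hj using hmem
    obtain ⟨k, hk⟩ := hI (insert i (Set.range j)) <| by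
      rw [Set.insert_eq]
      exact mk_union_le_of_le hκ (by simpa using one_le_aleph0.trans hκ) (mk_range_le.trans hT)
    exact ⟨k, hk i (Set.mem_insert _ _), T, hTX, hBT, fun t ht ↦
      hmono (hk _ (Set.mem_insert_of_mem _ ⟨⟨t, ht⟩, rfl⟩)).le (hj ⟨t, ht⟩)⟩
  choose k hk T hTX hBT hTB using hstep
  let a (n : ℕ) : I := k^[n] (Classical.arbitrary I)
  have ha (n) : a (n + 1) = k (a n) := Function.iterate_succ_apply' _ _ _
  have halt (n) : a n < a (n + 1) := ha n ▸ hk (a n)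
  obtain ⟨i₀, hi₀⟩ := hI (Set.range a) ((Set.countable_range a).le_aleph0.trans hκ)
  obtain ⟨i, hi, hmin⟩ := WellFounded.has_min (wellFounded_lt (α := I))
    {i | ∀ n, a n < i} ⟨i₀, fun n ↦ hi₀ _ ⟨n, rfl⟩⟩
  have hlt {j} (hj : j < i) : ∃ n, j ≤ a n := by
    by_contra! h
    exact hmin j h hj
  refine ⟨i, ⋃ n, T (a n), Set.iUnion_subset fun n ↦ hTX _, le_antisymm ?_ ?_⟩
  · refine span_le.2 (Set.iUnion_subset fun n ↦ (hTB _).trans ?_)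
    exact hmono (ha n ▸ (hi (n + 1)).le)
  · rw [hcont i (fun j hj ↦ ?_) ⟨_, hi 0⟩]
    · refine iSup₂_le fun j hj ↦ ?_
      obtain ⟨n, hn⟩ := hlt hj
      exact (hmono hn).trans ((hBT _).trans
        (span_mono (Set.subset_iUnion (fun n ↦ T (a n)) n)))
    · obtain ⟨n, hn⟩ := hlt hj
      exact ⟨a (n + 1), hi _, hn.trans_lt (halt n)⟩

theorem exists_isFreelySplit {κ : Cardinal.{u}} (hκ : ℵ₀ ≤ κ)
    (hfree : ∀ H : Submodule ℤ G, #H ≤ Order.succ κ → Module.Free ℤ H)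
    {A : Submodule ℤ G} (hA : #A ≤ κ) :
    ∃ B, A ≤ B ∧ #B ≤ κ ∧ IsFreelySplit κ B := by
  by_contra! h
  simp only [IsFreelySplit] at h
  push Not at h
  choose! f hle hfcard hf using h
  let I := (Order.succ κ).ord.ToType
  have hIcard : #I = Order.succ κ := mk_ord_toType _
  have hI (s : Set I) (hs : #s ≤ κ) : ∃ i, ∀ j ∈ s, j < i := by
    rw [← not_isCofinal_iff]
    intro hcof
    have := (Order.cof_le hcof).trans hs
    rw [Ordinal.cof_toType, (isRegular_succ hκ).cof_ord] at this
    exact this.not_gt (Order.lt_succ κ)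
  have : Nonempty I := ⟨(hI ∅ (by simp)).choose⟩
  obtain ⟨B, hB⟩ : ∃ B : I → Submodule ℤ G, ∀ i, B i = A ⊔ ⨆ j : Set.Iio i, f (B j) :=
    ⟨wellFounded_lt.fix fun i B ↦ A ⊔ ⨆ j : Set.Iio i, f (B j j.2),
      fun i ↦ wellFounded_lt.fix_eq _ i⟩
  have hAB (i) : A ≤ B i := hB i ▸ le_sup_left
  have hcard (i) : #(B i) ≤ κ := by
    induction i using WellFoundedLT.induction with
    | ind i ih =>
      rw [hB i]
      refine mk_sup_int_le hκ hA (mk_iSup_int_le hκ ?_ fun j ↦ hfcard _ (hAB _) (ih j j.2))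
      exact Order.lt_succ_iff.1 ((mk_Iio_lt i (by simp [I])).trans_eq hIcard)
  have hfB {i j} (hij : i < j) : f (B i) ≤ B j :=
    hB j ▸ le_sup_of_le_right (le_iSup (fun i : Set.Iio j ↦ f (B i)) ⟨i, hij⟩)
  have hmono : Monotone B := monotone_iff_forall_lt.2 fun i j hij ↦
    (hle _ (hAB i) (hcard i)).trans (hfB hij)
  have hcont (i) (hlim : ∀ j < i, ∃ k < i, j < k) (hne : ∃ j, j < i) : B i = ⨆ j < i, B j := by
    refine le_antisymm ?_ (iSup₂_le fun j hj ↦ hmono hj.le)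
    rw [hB i]
    obtain ⟨j, hj⟩ := hne
    refine sup_le ((hAB j).trans (le_iSup₂_of_le j hj le_rfl)) (iSup_le fun j ↦ ?_)
    obtain ⟨k, hk, hjk⟩ := hlim j j.2
    exact (hfB hjk).trans (le_iSup₂_of_le k hk le_rfl)
  have := hfree (⨆ i, B i) <| mk_iSup_int_le (hκ.trans (Order.le_succ κ)) hIcard.le
    fun i ↦ (hcard i).trans (Order.le_succ κ)
  obtain ⟨X, hXind, hX⟩ := (⨆ i, B i).exists_linearIndepOn_span_eq
  obtain ⟨i, Y, hYX, hY⟩ := exists_span_eq_of_continuous_chain hκ hI hmono hcard hcont hX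
  have hsplit : HasFreeComplIn (B i) (⨆ i, B i) := hY ▸ hX ▸ hasFreeComplIn_span hXind hYX
  obtain ⟨j, hj⟩ := hI {i} (by simpa using one_le_aleph0.trans hκ)
  exact hf _ (hAB i) (hcard i) <| hsplit.of_le (hle _ (hAB i) (hcard i))
    ((hfB (hj i rfl)).trans (le_iSup B j))

theorem free_of_iUnion_eq_univ {J : Type u} [LinearOrder J] [WellFoundedLT J]
    {κ : J → Cardinal.{u}} (hmono : Monotone κ) (hκ : ∀ j, ℵ₀ ≤ κ j) (hJ : ∀ j, #J ≤ κ j)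
    (hfree : ∀ j, ∀ H : Submodule ℤ G, #H ≤ κ j → Module.Free ℤ H)
    (hsplit : ∀ j, ∀ A : Submodule ℤ G, #A ≤ κ j → ∃ B, A ≤ B ∧ #B ≤ κ j ∧ IsFreelySplit (κ j) B)
    {A : J → Set G} (hA : ∀ j, #(A j) ≤ κ j) (hAU : ⋃ j, A j = Set.univ) : Module.Free ℤ G := by
  let P (j : J) (X : Set G) : Prop :=
    LinearIndepOn ℤ id X ∧ #(span ℤ X) ≤ κ j ∧ IsFreelySplit (κ j) (span ℤ X)
  have hPcard {j X} (h : P j X) : #X ≤ κ j := (mk_le_mk_of_subset subset_span).trans h.2.1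
  have hinit (j) : ∃ X, P j X ∧ A j ⊆ span ℤ X := by
    obtain ⟨B, hAB, hB, hBsplit⟩ := hsplit j (span ℤ (A j)) (mk_span_int_le (hκ j) (hA j))
    have := hfree j B hB
    obtain ⟨X, hX, rfl⟩ := B.exists_linearIndepOn_span_eq
    exact ⟨X, ⟨hX, hB, hBsplit⟩, span_le.1 hAB⟩
  have hext (j X) (hX : P j X) (D : Set G) (hD : #D ≤ κ j) :
      ∃ Y, P j Y ∧ X ⊆ Y ∧ D ⊆ span ℤ Y := by
    obtain ⟨B, hB, hBcard, hBsplit⟩ := hsplit j (span ℤ (X ∪ D))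
      (mk_span_int_le (hκ j) (mk_union_le_of_le (hκ j) (hPcard hX) hD))
    rw [span_le, Set.union_subset_iff] at hB
    obtain ⟨Y, hXY, hY, rfl⟩ := (hX.2.2 B (span_le.2 hB.1) hBcard).exists_linearIndepOn hX.1 rfl
    exact ⟨Y, ⟨hY, hBcard, hBsplit⟩, hXY, hB.2⟩
  have hstep (X : J → Set G) (hX : ∀ j, P j (X j)) : ∃ Y : J → Set G, (∀ j, P j (Y j)) ∧
      ∀ j, X j ⊆ Y j ∧ (∀ i < j, X i ⊆ span ℤ (Y j)) ∧
        ∀ i, ∀ x ∈ span ℤ (X j), x ∈ span ℤ (X i) → x ∈ span ℤ (X i ∩ span ℤ (Y j)) := by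
    have hsupp (i j) : ∃ T ⊆ X i, #T ≤ κ j ∧
        (span ℤ (X i) ∩ span ℤ (X j) : Set G) ⊆ span ℤ T :=
      exists_subset_subset_span (hκ j) Set.inter_subset_left
        ((mk_le_mk_of_subset Set.inter_subset_right).trans (hX j).2.1)
    choose T hTX hT hXT using hsupp
    have hD (j) := hext j (X j) (hX j) ((⋃ i : Set.Iio j, X i) ∪ ⋃ i, T i j) <|
      mk_union_le_of_le (hκ j)
        (mk_iUnion_le_of_forall (hκ j) ((mk_set_le _).trans (hJ j)) fun i ↦
          (hPcard (hX i)).trans (hmono i.2.le))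
        (mk_iUnion_le_of_forall (hκ j) (hJ j) fun i ↦ hT i j)
    choose Y hY hXY hDY using hD
    refine ⟨Y, hY, fun j ↦ ⟨hXY j, fun i hij ↦ ?_, fun i x hxj hxi ↦ ?_⟩⟩
    · exact (Set.subset_iUnion (fun i : Set.Iio j ↦ X i) ⟨i, hij⟩).trans
        (Set.subset_union_left.trans (hDY j))
    · exact span_mono (Set.subset_inter (hTX i j) ((Set.subset_iUnion (fun i ↦ T i j) i).trans
        (Set.subset_union_right.trans (hDY j)))) (hXT i j ⟨hxi, hxj⟩)
  choose X₀ hX₀ hAX₀ using hinit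
  choose! F hFP hF using hstep
  let X (n : ℕ) : J → Set G := F^[n] X₀
  have hXsucc (n) : X (n + 1) = F (X n) := Function.iterate_succ_apply' _ _ _
  have hXP (n) : ∀ j, P j (X n j) := by
    induction n with
    | zero => exact hX₀
    | succ n ih => exact hXsucc n ▸ hFP _ ih
  have hsub (n j) : X n j ⊆ X (n + 1) j := hXsucc n ▸ (hF _ (hXP n) j).1
  have hlt (n) {i j} (hij : i < j) : X n i ⊆ span ℤ (X (n + 1) j) :=
    hXsucc n ▸ (hF _ (hXP n) j).2.1 i hij
  have hclosed (n i j) : ∀ x ∈ span ℤ (X n j), x ∈ span ℤ (X n i) →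
      x ∈ span ℤ (X n i ∩ span ℤ (X (n + 1) j)) := hXsucc n ▸ (hF _ (hXP n) j).2.2 i
  let Z (j : J) : Set G := ⋃ n, X n j
  have hXZ (n j) : X n j ⊆ Z j := Set.subset_iUnion (fun n ↦ X n j) n
  have hZ (j) : LinearIndepOn ℤ id (Z j) :=
    linearIndepOn_iUnion_of_directed (monotone_nat_of_le_succ fun n ↦ hsub n j).directed_le
      fun n ↦ (hXP n j).1
  have hZle {i j} (hij : i < j) : span ℤ (Z i) ≤ span ℤ (Z j) :=
    span_le.2 (Set.iUnion_subset fun n ↦ (hlt n hij).trans (span_mono (hXZ _ _)))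
  have hZspan {i j} (hij : i < j) : span ℤ (Z i) ≤ span ℤ (Z j ∩ span ℤ (Z i)) := by
    refine span_le.2 (Set.iUnion_subset fun n x hx ↦ ?_)
    exact span_mono (Set.inter_subset_inter (hXZ _ _) (span_mono (hXZ _ _)))
      (hclosed (n + 1) j i x (subset_span (hsub n i hx)) (hlt n hij hx))
  refine free_of_hasFreeComplIn_iSup_lt (A := fun j ↦ span ℤ (Z j)) (fun j ↦ ?_) ?_
  · have : ⨆ i < j, span ℤ (Z i) = span ℤ (Z j ∩ (⨆ i < j, span ℤ (Z i) : Submodule ℤ G)) := by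
      refine le_antisymm (iSup₂_le fun i hi ↦ (hZspan hi).trans ?_)
        (span_le.2 Set.inter_subset_right)
      exact span_mono (Set.inter_subset_inter_right _
        (le_iSup₂ (f := fun i (_ : i < j) ↦ span ℤ (Z i)) i hi))
    rw [this]
    exact hasFreeComplIn_span (hZ j) Set.inter_subset_left
  · refine eq_top_iff.2 fun x _ ↦ ?_
    obtain ⟨j, hj⟩ := Set.mem_iUnion.1 (hAU ▸ Set.mem_univ x)
    exact mem_iSup_of_mem j (span_mono (hXZ 0 j) (hAX₀ j hj))

theorem free_of_isSingular {lam : Cardinal.{u}} (hlam : lam.IsSingular) (hcard : #G = lam)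
    (hfree : ∀ H : Submodule ℤ G, #H < lam → Module.Free ℤ H) : Module.Free ℤ G := by
  have hlim := hlam.isSuccLimit
  have hunc : ℵ₀ < lam := hlam.aleph0_le.lt_of_ne fun h ↦ not_isSingular_aleph0 (h ▸ hlam)
  obtain ⟨e⟩ := Cardinal.eq.1 (hcard.trans (mk_ord_toType lam).symm)
  obtain ⟨J, hcof, hJ⟩ := Order.exists_cof_eq lam.ord.ToType
  rw [Ordinal.cof_toType] at hJ
  have hJlam : #J < lam := hJ ▸ hlam.cof_ord_lt
  let A (j : J) : Set G := e ⁻¹' Set.Iic j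
  have hA (j) : #(A j) < lam := by
    rw [mk_preimage_equiv]
    have := mk_Iic_lt (j : lam.ord.ToType) (by simp) (by simpa using hlam.aleph0_le)
    simpa using this
  let κ (j : J) : Cardinal.{u} := max (max ℵ₀ #J) #(A j)
  have hκ (j) : κ j < lam := max_lt (max_lt hunc hJlam) (hA j)
  refine free_of_iUnion_eq_univ (κ := κ) (A := A) (fun i j hij ↦ ?_)
    (fun j ↦ (le_max_left _ _).trans (le_max_left _ _))
    (fun j ↦ (le_max_right _ _).trans (le_max_left _ _))
    (fun j H hH ↦ hfree H (hH.trans_lt (hκ j)))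
    (fun j B hB ↦ exists_isFreelySplit ((le_max_left _ _).trans (le_max_left _ _))
      (fun H hH ↦ hfree H (hH.trans_lt (hlim.succ_lt (hκ j)))) hB)
    (fun j ↦ le_max_right _ _) (Set.eq_univ_of_forall fun x ↦ ?_)
  · exact max_le_max le_rfl (mk_le_mk_of_subset
      (Set.preimage_mono (Set.Iic_subset_Iic.2 hij)))
  · obtain ⟨j, hj, hxj⟩ := hcof (e x)
    exact Set.mem_iUnion.2 ⟨⟨j, hj⟩, hxj⟩

end Submodule

end

/-- singular compactness for abelian groups. -/
theorem stmt3 (lam : Cardinal.{u})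
    (hinf : Cardinal.aleph0 ≤ lam) (hsing : lam.ord.cof < lam)
    (G : Type u) [AddCommGroup G] (hcard : Cardinal.mk G = lam)
    (hfree : ∀ H : AddSubgroup G, Cardinal.mk H < lam → IsFreeAbelian H) :
    IsFreeAbelian G :=
  Submodule.free_of_isSingular ⟨hinf, hsing.ne⟩ hcard fun H hH ↦
    have : Module.Free ℤ H.toAddSubgroup := hfree H.toAddSubgroup hH
    .of_equiv (AddEquiv.refl H).toIntLinearEquiv
end

section
/- If there exists an uncountable cardinal λ such that there is a λ-free abelian group of cardinality λ which is not free, then the least such cardinal is regular. -/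
universe u

/-- There is a λ-free abelian group of cardinality λ which is not free. -/
def ExistsAlmostFreeNonfree (lam : Cardinal.{u}) : Prop :=
  ∃ (G : Type u) (inst : AddCommGroup G),
    Cardinal.mk G = lam ∧ @IsKappaFree lam G inst ∧ ¬ @IsFreeAbelian G inst

open Submodule in
/-- The union of an increasing sequence of submodules, starting at `⊥`, in which each term has a
free complement in the next one, is free. -/
theorem Module.Free.of_filtration {R M : Type*} [Ring R] [AddCommGroup M] [Module R M]
    (N C : ℕ → Submodule R M) (hN : Monotone N) (h_zero : N 0 = ⊥) (h_top : ∀ x, ∃ n, x ∈ N n)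
    (h_disj : ∀ n, Disjoint (N n) (C n)) (h_sup : ∀ n, N (n + 1) = N n ⊔ C n)
    (h_free : ∀ n, Module.Free R (C n)) : Module.Free R M := by
  classical
  have hC : ∀ {i n}, i < n → C i ≤ N n := fun {i n} hin =>
    (le_sup_right.trans (h_sup i).ge).trans (hN hin)
  have h_inj : Function.Injective (DirectSum.coeLinearMap C) := by
    rw [← LinearMap.ker_eq_bot, LinearMap.ker_eq_bot']
    intro x hx
    by_contra hne
    have h_nonempty : (DFinsupp.support x).Nonempty := by
      rwa [Finset.nonempty_iff_ne_empty, Ne, DFinsupp.support_eq_empty]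
    set m := (DFinsupp.support x).max' h_nonempty
    have hm : m ∈ DFinsupp.support x := Finset.max'_mem _ _
    rw [DirectSum.coeLinearMap_eq_dfinsuppSum, DFinsupp.sum, ← Finset.add_sum_erase _ _ hm] at hx
    have h_rest : ∑ i ∈ (DFinsupp.support x).erase m, (x i : M) ∈ N m :=
      sum_mem fun i hi => hC (lt_of_le_of_ne (Finset.le_max' _ _ (Finset.mem_of_mem_erase hi))
        (Finset.ne_of_mem_erase hi)) (x i).2
    have hxm : (x m : M) ∈ N m := by
      rw [eq_neg_of_add_eq_zero_left hx]
      exact neg_mem h_rest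
    have : (x m : M) = 0 := disjoint_def.1 (h_disj m) _ hxm (x m).2
    exact DFinsupp.mem_support_iff.1 hm (Subtype.ext this)
  have h_surj : Function.Surjective (DirectSum.coeLinearMap C) := by
    rw [← LinearMap.range_eq_top, DirectSum.range_coeLinearMap, eq_top_iff]
    have : ∀ n, N n ≤ iSup C := by
      intro n
      induction n with
      | zero => simp [h_zero]
      | succ n ih => exact (h_sup n).trans_le (sup_le ih (le_iSup C n))
    intro x _
    obtain ⟨n, hn⟩ := h_top x
    exact this n hn
  exact Module.Free.of_equiv (LinearEquiv.ofBijective _ ⟨h_inj, h_surj⟩)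

/-- A submodule `N` of `P` such that `P` is finitely generated and `P / N` is torsion-free has a free
complement in `P`, over a principal ideal domain. -/
theorem Submodule.exists_free_complement {R M : Type*} [CommRing R] [IsDomain R]
    [IsPrincipalIdealRing R] [AddCommGroup M] [Module R M] {N P : Submodule R M} (hNP : N ≤ P)
    [Module.Finite R P] (h_pure : ∀ (r : R) (x : M), r ≠ 0 → r • x ∈ N → x ∈ N) :
    ∃ C : Submodule R M, Disjoint N C ∧ P = N ⊔ C ∧ Module.Free R C := by
  let π := N.mkQ.comp P.subtype
  have : Module.IsTorsionFree R (M ⧸ N) := by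
    refine .of_smul_eq_zero fun r y h => ?_
    obtain ⟨x, rfl⟩ := N.mkQ_surjective y
    by_cases hr : r = 0
    · exact Or.inl hr
    · right
      rw [← map_smul, Submodule.mkQ_apply, Submodule.Quotient.mk_eq_zero] at h
      rw [Submodule.mkQ_apply, Submodule.Quotient.mk_eq_zero]
      exact h_pure r x hr h
  have : Module.Free R (LinearMap.range π) := Module.free_of_finite_type_torsion_free'
  obtain ⟨s, hs⟩ := Module.projective_lifting_property π.rangeRestrict LinearMap.id
    π.surjective_rangeRestrict
  have hs' : ∀ y, N.mkQ (s y) = y := fun y => congrArg Subtype.val (LinearMap.congr_fun hs y)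
  let t := P.subtype.comp s
  have ht : Function.Injective t := fun y z h => Subtype.ext <| by
    rw [← hs' y, ← hs' z]; exact congrArg N.mkQ h
  refine ⟨LinearMap.range t, ?_, ?_, Module.Free.of_equiv (LinearEquiv.ofInjective t ht)⟩
  · rw [Submodule.disjoint_def]
    rintro _ hx ⟨y, rfl⟩
    have : y = 0 := Subtype.ext <| by
      rw [← hs' y]; exact (Submodule.Quotient.mk_eq_zero N).2 hx
    rw [this, map_zero]
  · refine le_antisymm (fun x hx => ?_) (sup_le hNP ?_)
    · let y := π.rangeRestrict ⟨x, hx⟩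
      have : x - t y ∈ N := by
        rw [← Submodule.Quotient.mk_eq_zero, ← Submodule.mkQ_apply, map_sub, sub_eq_zero]
        exact (hs' y).symm
      rw [← sub_add_cancel x (t y)]
      exact Submodule.add_mem_sup this ⟨y, rfl⟩
    · rintro _ ⟨y, rfl⟩
      exact (s y).2

/-- Finitely many coordinates separate the points of a finite-dimensional space of sequences. -/
theorem Submodule.exists_coordinates_injective {K : Type*} [Field K] (V : Submodule K (ℕ → K))
    [FiniteDimensional K V] : ∃ n, ∀ x ∈ V, (∀ i < n, x i = 0) → x = 0 := by
  let F : ℕ →o (Submodule K V)ᵒᵈ :=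
    { toFun := fun n => OrderDual.toDual
        { carrier := {x | ∀ i < n, (x : ℕ → K) i = 0}
          add_mem' := fun hx hy i hi => by simp [hx i hi, hy i hi]
          zero_mem' := fun i _ => rfl
          smul_mem' := fun c x hx i hi => by simp [hx i hi] }
      monotone' := fun m n hmn x hx i hi => hx i (hi.trans_le hmn) }
  obtain ⟨n, hn⟩ := IsArtinian.monotone_stabilizes F
  refine ⟨n, fun x hx h => funext fun i => ?_⟩
  have hmem : (⟨x, hx⟩ : V) ∈ OrderDual.ofDual (F n) := h
  rw [hn (n + i + 1) (by lia)] at hmem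
  exact hmem i (by lia)

/-- Specker's theorem: every countable subgroup of `ℤ^ℕ` is free. -/
theorem Module.Free.of_countable_of_injective {H : Type*} [AddCommGroup H] [Countable H]
    (f : H →ₗ[ℤ] ℕ → ℤ) (hf : Function.Injective f) : Module.Free ℤ H := by
  obtain ⟨h, hh⟩ := exists_surjective_nat H
  let g : H →ₗ[ℤ] ℕ → ℚ := ((Int.castAddHom ℚ).toIntLinearMap.compLeft ℕ).comp f
  have hg : ∀ x i, g x i = f x i := fun _ _ => rfl
  have hg_inj : Function.Injective g := fun x y hxy => hf <| funext fun i => by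
    have := congrFun hxy i
    rwa [hg, hg, Int.cast_inj] at this
  let V : ℕ → Submodule ℚ (ℕ → ℚ) := fun n => Submodule.span ℚ ((g ∘ h) '' Set.Iio n)
  have hV : Monotone V := fun m n hmn =>
    Submodule.span_mono (Set.image_mono (Set.Iio_subset_Iio hmn))
  let N : ℕ → Submodule ℤ H := fun n => ((V n).restrictScalars ℤ).comap g
  have hmem : ∀ {n x}, x ∈ N n ↔ g x ∈ V n := Iff.rfl
  have hN : Monotone N := fun m n hmn x hx => hV hmn hx
  have h_finite : ∀ n, Module.Finite ℤ (N n) := by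
    intro n
    have : FiniteDimensional ℚ (V n) :=
      FiniteDimensional.span_of_finite ℚ ((Set.finite_Iio n).image _)
    obtain ⟨m, hm⟩ := (V n).exists_coordinates_injective
    let p : N n →ₗ[ℤ] Fin m → ℤ := (LinearMap.funLeft ℤ ℤ Fin.val).comp (f.comp (N n).subtype)
    refine Module.Finite.of_injective p ?_
    rw [← LinearMap.ker_eq_bot, LinearMap.ker_eq_bot']
    intro x hx
    refine Subtype.ext (hg_inj ?_)
    rw [ZeroMemClass.coe_zero, map_zero]
    refine hm _ x.2 fun i hi => ?_
    rw [hg, Int.cast_eq_zero]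
    exact congrFun hx ⟨i, hi⟩
  have h_compl : ∀ n, ∃ C : Submodule ℤ H,
      Disjoint (N n) C ∧ N (n + 1) = N n ⊔ C ∧ Module.Free ℤ C := fun n =>
    Submodule.exists_free_complement (hN n.le_succ) fun r x hr hx => by
      rw [hmem, map_smul, ← Int.cast_smul_eq_zsmul ℚ] at hx
      exact ((V n).smul_mem_iff (Int.cast_ne_zero.2 hr)).1 hx
  choose C h_disj h_sup h_free using h_compl
  refine Module.Free.of_filtration N C hN ?_ (fun x => ?_) h_disj h_sup h_free
  · rw [eq_bot_iff]
    intro x hx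
    have : g x = 0 := by simpa [V] using hmem.1 hx
    exact hg_inj (this.trans (map_zero g).symm)
  · obtain ⟨n, rfl⟩ := hh x
    exact ⟨n + 1, hmem.2 (Submodule.subset_span ⟨n, n.lt_succ_self, rfl⟩)⟩

/-- A free abelian group with a countable subset on which no nonzero homomorphism to `ℤ` vanishes
is countable. -/
theorem Module.Free.countable_of_forall_hom_eq_zero {M : Type*} [AddCommGroup M] [Module.Free ℤ M]
    (e : ℕ → M) (he : ∀ φ : M →ₗ[ℤ] ℤ, (∀ n, φ (e n) = 0) → φ = 0) : Countable M := by
  let b := Module.Free.chooseBasis ℤ M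
  have h_cover : ⋃ n, ((b.repr (e n)).support : Set (Module.Free.ChooseBasisIndex ℤ M)) =
      Set.univ := by
    refine Set.eq_univ_of_forall fun i => ?_
    by_contra hi
    simp only [Set.mem_iUnion, Finset.mem_coe, Finsupp.mem_support_iff, not_exists, not_not] at hi
    have := LinearMap.congr_fun (he (b.coord i) hi) (b i)
    simp at this
  have : Countable (Module.Free.ChooseBasisIndex ℤ M) := by
    rw [← Set.countable_univ_iff, ← h_cover]
    exact Set.countable_iUnion fun n => Finset.countable_toSet _
  exact b.repr.toEquiv.countable_iff.2 inferInstance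

/-- The sequence whose `k`-th term is `2 ^ (k - j)` for `k ∈ s` and `0` otherwise, with truncated
subtraction in the exponent. -/
noncomputable def shiftedPowers (s : Set ℕ) (j k : ℕ) : ℤ :=
  s.indicator (fun k => 2 ^ (k - j)) k

theorem shiftedPowers_zero_injective : Function.Injective fun s => shiftedPowers s 0 := by
  have h_mem : ∀ (s : Set ℕ) k, k ∈ s ↔ shiftedPowers s 0 k ≠ 0 := fun s k => by
    simp [shiftedPowers]
  intro s t hst
  ext k
  rw [h_mem s, h_mem t, show shiftedPowers s 0 = shiftedPowers t 0 from hst]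

theorem shiftedPowers_eq_two_mul {s : Set ℕ} {j k : ℕ} (hjk : j < k) :
    shiftedPowers s j k = 2 * shiftedPowers s (j + 1) k := by
  by_cases hk : k ∈ s
  · simp only [shiftedPowers, Set.indicator_of_mem hk]
    rw [← pow_succ']
    congr 1
    lia
  · simp [shiftedPowers, hk]

/-- The standard basis vectors of `ℤ^ℕ` together with the sequences `shiftedPowers s j` for
`s ∈ T`. -/
noncomputable def almostFreeGenerators (T : Set (Set ℕ)) : T × ℕ ⊕ ℕ → ℕ → ℤ :=
  Sum.elim (fun p => shiftedPowers p.1 p.2) (fun n => Pi.single n 1)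

/-- The subgroup of `ℤ^ℕ` generated by `almostFreeGenerators T`. -/
noncomputable def almostFreeSubgroup (T : Set (Set ℕ)) : Submodule ℤ (ℕ → ℤ) :=
  Submodule.span ℤ (Set.range (almostFreeGenerators T))

theorem almostFreeGenerators_mem (T : Set (Set ℕ)) (i : T × ℕ ⊕ ℕ) :
    almostFreeGenerators T i ∈ almostFreeSubgroup T :=
  Submodule.subset_span ⟨i, rfl⟩

theorem almostFreeSubgroup_hom_eq_zero (T : Set (Set ℕ)) (φ : almostFreeSubgroup T →ₗ[ℤ] ℤ)
    (hφ : ∀ n, φ ⟨_, almostFreeGenerators_mem T (.inr n)⟩ = 0) : φ = 0 := by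
  have h_halve : ∀ s j, φ ⟨_, almostFreeGenerators_mem T (.inl (s, j))⟩ =
      2 * φ ⟨_, almostFreeGenerators_mem T (.inl (s, j + 1))⟩ := by
    intro s j
    have h_eq : (⟨_, almostFreeGenerators_mem T (.inl (s, j))⟩ : almostFreeSubgroup T) =
        (2 : ℤ) • ⟨_, almostFreeGenerators_mem T (.inl (s, j + 1))⟩ +
        ∑ i ∈ Finset.range (j + 1), (shiftedPowers s j i - 2 * shiftedPowers s (j + 1) i) •
          (⟨_, almostFreeGenerators_mem T (.inr i)⟩ : almostFreeSubgroup T) := by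
      ext k
      simp only [almostFreeGenerators, Sum.elim_inl, Sum.elim_inr, Submodule.coe_add,
        Submodule.coe_smul, Submodule.coe_sum, Pi.add_apply, Pi.smul_apply, Finset.sum_apply,
        smul_eq_mul, Pi.single_apply, mul_ite, mul_one, mul_zero, Finset.sum_ite_eq,
        Finset.mem_range]
      split_ifs with hk
      · ring
      · rw [shiftedPowers_eq_two_mul (by lia), add_zero]
    rw [h_eq, map_add, map_sum, map_smul, smul_eq_mul, Finset.sum_eq_zero, add_zero]
    intro i _
    rw [map_smul, hφ, smul_zero]
  have h_pow : ∀ s n j, (2 : ℤ) ^ n ∣ φ ⟨_, almostFreeGenerators_mem T (.inl (s, j))⟩ := by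
    intro s n
    induction n with
    | zero => simp
    | succ n ih =>
      intro j
      rw [h_halve, pow_succ']
      exact mul_dvd_mul_left 2 (ih (j + 1))
  have h_gen : ∀ i, φ ⟨_, almostFreeGenerators_mem T i⟩ = 0 := by
    rintro (⟨s, j⟩ | n)
    · set z := φ ⟨_, almostFreeGenerators_mem T (.inl (s, j))⟩ with hz
      refine Int.eq_zero_of_abs_lt_dvd (hz ▸ h_pow s z.natAbs j) ?_
      rw [Int.abs_eq_natAbs]
      exact_mod_cast Nat.lt_two_pow_self
    · exact hφ n
  refine LinearMap.ext fun ⟨x, hx⟩ => ?_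
  rw [LinearMap.zero_apply]
  unfold almostFreeSubgroup at hx
  induction hx using Submodule.span_induction with
  | mem x h => obtain ⟨i, rfl⟩ := h; exact h_gen i
  | zero => exact map_zero φ
  | add x y hx hy hx' hy' =>
    exact (map_add φ ⟨x, hx⟩ ⟨y, hy⟩).trans (by rw [hx', hy', add_zero])
  | smul r x hx hx' => exact (map_smul φ r ⟨x, hx⟩).trans (by rw [hx', smul_zero])

open Cardinal in
theorem mk_almostFreeSubgroup {T : Set (Set ℕ)} (hT : ℵ₀ ≤ #T) :
    #(almostFreeSubgroup T) = #T := by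
  refine le_antisymm ?_ (mk_le_of_injective (f := fun s =>
    ⟨_, almostFreeGenerators_mem T (.inl (s, 0))⟩) fun s t hst =>
      Subtype.ext (shiftedPowers_zero_injective (congrArg Subtype.val hst)))
  have h_range : (almostFreeSubgroup T : Set (ℕ → ℤ)) =
      Set.range (Finsupp.linearCombination ℤ (almostFreeGenerators T)) := by
    rw [almostFreeSubgroup, ← Finsupp.range_linearCombination, LinearMap.coe_range]
  calc #(almostFreeSubgroup T)
      = #(Set.range (Finsupp.linearCombination ℤ (almostFreeGenerators T))) := by
        rw [← h_range]; rfl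
    _ ≤ #((T × ℕ ⊕ ℕ) →₀ ℤ) := mk_range_le
    _ = #T := by
      rw [mk_finsupp_of_infinite]
      simp [hT, add_eq_left]

open Cardinal in
theorem existsAlmostFreeNonfree_aleph_one : ExistsAlmostFreeNonfree.{u} ℵ₁ := by
  have h_le : ℵ₁ ≤ #(Set ℕ) := by
    rw [mk_set, mk_nat, two_power_aleph0]
    exact aleph_one_le_continuum
  obtain ⟨T, hT⟩ := le_mk_iff_exists_set.1 h_le
  have h_mk : #(almostFreeSubgroup T) = ℵ₁ :=
    (mk_almostFreeSubgroup (hT ▸ aleph0_lt_aleph_one.le)).trans hT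
  refine ⟨ULift.{u} (almostFreeSubgroup T), inferInstance, ?_, fun H hH => ?_, fun h_free => ?_⟩
  · rw [mk_uLift, h_mk, lift_aleph, Ordinal.lift_one]
  · have : Countable H := by
      rwa [← mk_le_aleph0_iff, ← Order.lt_succ_iff, succ_aleph0]
    let f : H →ₗ[ℤ] ℕ → ℤ := ((almostFreeSubgroup T).subtype.comp
      (ULift.moduleEquiv : ULift.{u} (almostFreeSubgroup T) ≃ₗ[ℤ] _).toLinearMap).comp
        H.subtype.toIntLinearMap
    exact Module.Free.of_countable_of_injective f (Subtype.val_injective.comp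
      (ULift.down_injective.comp Subtype.val_injective))
  · have : Module.Free ℤ (ULift.{u} (almostFreeSubgroup T)) := h_free
    have : Module.Free ℤ (almostFreeSubgroup T) :=
      Module.Free.of_equiv (ULift.moduleEquiv : ULift.{u} (almostFreeSubgroup T) ≃ₗ[ℤ] _)
    have : Countable (almostFreeSubgroup T) :=
      Module.Free.countable_of_forall_hom_eq_zero _ (almostFreeSubgroup_hom_eq_zero T)
    exact (mk_le_aleph0_iff.2 this).not_gt (h_mk ▸ aleph0_lt_aleph_one)

theorem stmt4 (κ : Cardinal.{u})
    (hκ : Cardinal.aleph0 < κ ∧ ExistsAlmostFreeNonfree κ)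
    (hleast : ∀ lam : Cardinal.{u},
      Cardinal.aleph0 < lam ∧ ExistsAlmostFreeNonfree lam → κ ≤ lam) :
    κ.IsRegular := by
  have h_le : κ ≤ Cardinal.aleph 1 :=
    hleast _ ⟨Cardinal.aleph0_lt_aleph_one, existsAlmostFreeNonfree_aleph_one⟩
  have h_ge : Cardinal.aleph 1 ≤ κ := by
    rw [← Cardinal.succ_aleph0]
    exact Order.succ_le_of_lt hκ.1
  rw [le_antisymm h_le h_ge]
  exact Cardinal.isRegular_aleph_one
end

section
/- Assume GCH. Suppose κ = μ⁺ is a successor cardinal which is the least uncountable cardinal λ such that there exists a λ-free non-free abelian group of cardinality λ. If G is a κ-free abelian group of cardinality κ which is a Whitehead group, then G is strongly κ-free. -/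
universe u

/-- The set of elements having a nonzero multiple in the subgroup generated by `S`. -/
def pureClosure {M : Type*} [AddCommGroup M] (S : Set M) : AddSubgroup M where
  carrier := {x | ∃ n : ℤ, n ≠ 0 ∧ n • x ∈ AddSubgroup.closure S}
  zero_mem' := ⟨1, one_ne_zero, by simp⟩
  add_mem' := by
    rintro x y ⟨m, hm, hx⟩ ⟨n, hn, hy⟩
    refine ⟨m * n, mul_ne_zero hm hn, ?_⟩
    rw [smul_add, mul_comm m n, mul_smul, mul_comm n m, mul_smul]
    exact add_mem (zsmul_mem hx n) (zsmul_mem hy m)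
  neg_mem' := by
    rintro x ⟨m, hm, hx⟩
    exact ⟨m, hm, by simpa using hx⟩

section PureClosure

variable {M : Type*} [AddCommGroup M]

theorem subset_pureClosure (S : Set M) : S ⊆ pureClosure S := fun x hx =>
  ⟨1, one_ne_zero, by simpa using AddSubgroup.subset_closure hx⟩

theorem pureClosure_mono {S T : Set M} (h : S ⊆ T) : pureClosure S ≤ pureClosure T := by
  rintro x ⟨n, hn, hx⟩
  exact ⟨n, hn, AddSubgroup.closure_mono h hx⟩

theorem mem_pureClosure_of_zsmul_mem {S : Set M} {n : ℤ} (hn : n ≠ 0) {x : M}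
    (hx : n • x ∈ pureClosure S) : x ∈ pureClosure S := by
  obtain ⟨m, hm, h⟩ := hx
  exact ⟨m * n, mul_ne_zero hm hn, by rwa [mul_smul]⟩

theorem isAddTorsionFree_quotient_pureClosure (S : Set M) :
    IsAddTorsionFree (M ⧸ pureClosure S) := by
  rw [← Module.isTorsionFree_int_iff_isAddTorsionFree]
  refine .of_smul_eq_zero fun n x h => ?_
  induction x using QuotientAddGroup.induction_on with
  | H x =>
    rw [or_iff_not_imp_left]
    intro hn
    rw [← QuotientAddGroup.mk_zsmul, QuotientAddGroup.eq_zero_iff] at h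
    exact (QuotientAddGroup.eq_zero_iff x).2 (mem_pureClosure_of_zsmul_mem hn h)

theorem eqOn_pureClosure {N : Type*} [AddCommGroup N] [IsAddTorsionFree N] {S : Set M}
    {f g : M →+ N} (h : Set.EqOn f g S) : Set.EqOn f g (pureClosure S) := by
  rintro x ⟨n, hn, hx⟩
  have := AddMonoidHom.eqOn_closure h hx
  simp only [map_zsmul] at this
  exact zsmul_right_injective hn this

theorem mk_closure_le {M : Type*} [AddCommGroup M] (S : Set M) :
    Cardinal.mk (AddSubgroup.closure S) ≤ max (Cardinal.mk S) Cardinal.aleph0 := by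
  have h : Function.Surjective (fun f : S →₀ ℤ =>
      (⟨Finsupp.linearCombination ℤ ((↑) : S → M) f, by
        rw [← Submodule.span_int_eq_addSubgroupClosure]
        exact Finsupp.mem_span_iff_linearCombination ℤ S _ |>.2 ⟨f, rfl⟩⟩ :
          AddSubgroup.closure S)) := by
    rintro ⟨x, hx⟩
    rw [← Submodule.span_int_eq_addSubgroupClosure, Submodule.mem_toAddSubgroup,
      Finsupp.mem_span_iff_linearCombination] at hx
    obtain ⟨f, hf⟩ := hx
    exact ⟨f, Subtype.ext hf⟩
  refine (Cardinal.mk_le_of_surjective h).trans ?_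
  rcases isEmpty_or_nonempty S with hS | hS
  · exact Cardinal.mk_le_aleph0.trans (le_max_right _ _)
  · simp

theorem mk_pureClosure_le [IsAddTorsionFree M] (S : Set M) :
    Cardinal.mk (pureClosure S) ≤ max (Cardinal.mk S) Cardinal.aleph0 := by
  choose n hn hx using fun x : pureClosure S => x.2
  have hinj : Function.Injective (fun x : pureClosure S =>
      ((⟨n x • x, hx x⟩, ULift.up (n x)) : AddSubgroup.closure S × ULift ℤ)) := by
    intro x y h
    simp only [Prod.mk.injEq, Subtype.mk.injEq, ULift.up.injEq] at h
    rw [h.2] at h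
    exact Subtype.ext (zsmul_right_injective (hn y) h.1)
  refine (Cardinal.mk_le_of_injective hinj).trans ?_
  rw [Cardinal.mk_prod]
  simp only [Cardinal.lift_id]
  refine (mul_le_mul' (mk_closure_le S) Cardinal.mk_le_aleph0).trans ?_
  rw [Cardinal.mul_aleph0_eq (le_max_right _ _)]

end PureClosure

theorem exists_linearIndepOn_superset {R M : Type*} [CommRing R] [IsDomain R]
    [IsPrincipalIdealRing R] [AddCommGroup M] [Module R M] {N N' : Submodule R M}
    (hle : N ≤ N') (hfg : N'.FG) (hpure : ∀ n : R, n ≠ 0 → ∀ x ∈ N', n • x ∈ N → x ∈ N)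
    {S : Set M} (hS : LinearIndepOn R id S) (hspan : Submodule.span R S = N) :
    ∃ S', S ⊆ S' ∧ LinearIndepOn R id S' ∧ Submodule.span R S' = N' := by
  have : Module.Finite R (N'.map N.mkQ) := Module.Finite.iff_fg.2 (hfg.map _)
  have : Module.IsTorsionFree R (N'.map N.mkQ) := by
    refine .of_smul_eq_zero ?_
    rintro n ⟨_, x, hx, rfl⟩ h
    rw [or_iff_not_imp_left]
    intro hn
    have h' := congrArg Subtype.val h
    simp only [Submodule.coe_smul, ZeroMemClass.coe_zero, ← map_smul] at h'
    rw [Submodule.mkQ_apply, Submodule.Quotient.mk_eq_zero] at h'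
    ext
    simpa using hpure n hn x hx h'
  let b := Module.Free.chooseBasis R (N'.map N.mkQ)
  choose v hv hvb using fun i => (b i).2
  have hcomp : N.mkQ ∘ v = (N'.map N.mkQ).subtype ∘ b := funext hvb
  refine ⟨S ∪ Set.range v, Set.subset_union_left, ?_, le_antisymm ?_ ?_⟩
  · refine LinearIndepOn.union_id_of_quotient (M' := N) ?_ hS ?_
    · rw [← hspan]
      exact Submodule.subset_span
    · have := b.linearIndependent.map' _ (N'.map N.mkQ).ker_subtype
      have h2 : LinearIndependent R (N.mkQ ∘ v) := by
        rw [hcomp]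
        exact this
      exact (linearIndepOn_range_iff (Function.Injective.of_comp h2.injective) _).2 h2
  · refine Submodule.span_le.2 (Set.union_subset ?_ ?_)
    · exact fun x hx => hle (hspan ▸ Submodule.subset_span hx)
    · rintro _ ⟨i, rfl⟩
      exact hv i
  · intro x hx
    have h1 : N.mkQ x ∈ (Submodule.span R (Set.range v)).map N.mkQ := by
      rw [Submodule.map_span, ← Set.range_comp]
      have := b.mem_span ⟨N.mkQ x, x, hx, rfl⟩
      have := Submodule.mem_map_of_mem (f := (N'.map N.mkQ).subtype) this
      rw [Submodule.map_span, ← Set.range_comp] at this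
      rw [hcomp]
      exact this
    obtain ⟨y, hy, hyx⟩ := h1
    have h2 : x - y ∈ N := by
      rw [← Submodule.Quotient.mk_eq_zero, ← Submodule.mkQ_apply, map_sub, hyx, sub_self]
    rw [← hspan] at h2
    rw [← sub_add_cancel x y, Submodule.span_union]
    exact Submodule.add_mem_sup h2 hy

/-- Pontryagin's criterion: a countable non-free torsion-free group has a subgroup of finite rank
which is not finitely generated. -/
theorem exists_finiteRank_not_fg {M : Type*} [AddCommGroup M] [IsAddTorsionFree M]
    (B : AddSubgroup M) [Countable B] (hB : ¬ Module.Free ℤ B) :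
    ∃ (s : Set M) (A : AddSubgroup M), s.Finite ∧ ¬ A.FG ∧ s ⊆ A ∧
      A ≤ pureClosure s := by
  obtain ⟨b, hb⟩ := exists_surjective_nat B
  let s : ℕ → Set M := fun k => (fun i => (b i : M)) '' Set.Iio k
  let A : ℕ → AddSubgroup M := fun k => B ⊓ pureClosure (s k)
  have hmono : Monotone s := fun i j h => Set.image_mono (Set.Iio_subset_Iio h)
  by_contra! hcon
  have hfg : ∀ k, (A k).FG := fun k => by
    by_contra hk
    refine hcon (s k) (A k) ((Set.finite_Iio k).image _) hk ?_ inf_le_right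
    rintro _ ⟨i, hi, rfl⟩
    exact ⟨(b i).2, subset_pureClosure _ ⟨i, hi, rfl⟩⟩
  let P : ℕ → Set M → Prop := fun k S =>
    LinearIndepOn ℤ id S ∧ Submodule.span ℤ S = AddSubgroup.toIntSubmodule (A k)
  have step : ∀ k S, P k S → ∃ S', S ⊆ S' ∧ P (k + 1) S' := by
    rintro k S ⟨h1, h2⟩
    refine exists_linearIndepOn_superset ?_ ?_ ?_ h1 h2
    · exact inf_le_inf_left _ (pureClosure_mono (hmono k.le_succ))
    · simpa [Submodule.fg_iff_addSubgroup_fg] using hfg (k + 1)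
    · rintro n hn x ⟨hx, -⟩ ⟨-, h⟩
      exact ⟨hx, mem_pureClosure_of_zsmul_mem hn h⟩
  choose! f hf hfP using step
  let S : ℕ → Set M := fun k => Nat.rec ∅ f k
  have hP : ∀ k, P k (S k) := fun k => by
    induction k with
    | zero =>
      refine ⟨linearIndepOn_empty ℤ id, ?_⟩
      rw [eq_comm]
      change AddSubgroup.toIntSubmodule (A 0) = Submodule.span ℤ ∅
      rw [Submodule.span_empty, Submodule.eq_bot_iff]
      rintro x ⟨-, n, hn, hx⟩
      simpa [s, hn] using hx
    | succ k ih => exact hfP k _ ih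
  have hSmono : Monotone S := monotone_nat_of_le_succ fun k => hf k _ (hP k)
  have hli : LinearIndepOn ℤ id (⋃ k, S k) :=
    linearIndepOn_iUnion_of_directed hSmono.directed_le fun k => (hP k).1
  have hsp : Submodule.span ℤ (⋃ k, S k) = AddSubgroup.toIntSubmodule B := by
    refine le_antisymm (Submodule.span_le.2 (Set.iUnion_subset fun k x hx => ?_)) fun x hx => ?_
    · have := Submodule.subset_span (R := ℤ) hx
      rw [(hP k).2] at this
      exact this.1
    · obtain ⟨k, hk⟩ := hb ⟨x, hx⟩
      have : x ∈ AddSubgroup.toIntSubmodule (A (k + 1)) :=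
        ⟨hx, subset_pureClosure _ ⟨k, Nat.lt_succ_self k, by simp [hk]⟩⟩
      rw [← (hP (k + 1)).2] at this
      exact Submodule.span_mono (Set.subset_iUnion S (k + 1)) this
  have hb' := Module.Basis.span hli
  have : Module.Free ℤ (AddSubgroup.toIntSubmodule B) := by
    refine Module.Free.of_basis (hb'.map (LinearEquiv.ofEq _ _ ?_))
    simp only [id, Subtype.range_coe]
    exact hsp
  exact hB this

section Characters

variable {G : Type*} [AddCommGroup G]

theorem exists_character_extension (K : AddSubgroup G) (f : K →+ AddCircle (1 : ℚ)) :
    ∃ F : G →+ AddCircle (1 : ℚ), ∀ x : K, F x = f x := by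
  obtain ⟨F, hF⟩ := (Module.Baer.of_divisible (AddCircle (1 : ℚ))).extension_property_addMonoidHom
    K.subtype K.subtype_injective f
  exact ⟨F, DFunLike.congr_fun hF⟩

/-- Compatible characters on a chain of subgroups have a common extension. -/
theorem exists_character_of_compatible {ι : Type*} [LinearOrder ι] {B : ι → AddSubgroup G}
    (hB : Monotone B) {θ : ι → G →+ AddCircle (1 : ℚ)}
    (hθ : ∀ i j, i ≤ j → Set.EqOn (θ i) (θ j) (B i)) :
    ∃ F : G →+ AddCircle (1 : ℚ), ∀ i, Set.EqOn F (θ i) (B i) := by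
  rcases isEmpty_or_nonempty ι with hι | hι
  · exact ⟨0, isEmptyElim⟩
  have hmem : ∀ x : (⨆ i, B i : AddSubgroup G), ∃ i, (x : G) ∈ B i := fun x =>
    (AddSubgroup.mem_iSup_of_directed hB.directed_le).1 x.2
  choose k hk using hmem
  have key : ∀ (x : (⨆ i, B i : AddSubgroup G)) (i : ι), (x : G) ∈ B i →
      θ (k x) x = θ i x := fun x i hi => by
    rcases le_total (k x) i with h | h
    · exact hθ _ _ h (hk x)
    · exact (hθ _ _ h hi).symm
  let f : (⨆ i, B i : AddSubgroup G) →+ AddCircle (1 : ℚ) := AddMonoidHom.mk' (fun x => θ (k x) x)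
    (by
      intro x y
      have hx := hB (le_max_left (k x) (k y)) (hk x)
      have hy := hB (le_max_right (k x) (k y)) (hk y)
      rw [key x _ hx, key y _ hy, key (x + y) _ (add_mem hx hy), AddSubgroup.coe_add, map_add])
  obtain ⟨F, hF⟩ := exists_character_extension _ f
  exact ⟨F, fun i x hx => (hF ⟨x, le_iSup B i hx⟩).trans (key ⟨x, le_iSup B i hx⟩ i hx)⟩

theorem exists_character_vanishing {B : AddSubgroup G} {x : G} (hx : x ∉ B) :
    ∃ ρ : G →+ AddCircle (1 : ℚ), (∀ y ∈ B, ρ y = 0) ∧ ρ x ≠ 0 := by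
  have hx' : (x : G ⧸ B) ≠ 0 := by rwa [ne_eq, QuotientAddGroup.eq_zero_iff]
  obtain ⟨c, hc⟩ : ∃ c : (G ⧸ B) →+ AddCircle (1 : ℚ), c x ≠ 0 :=
    CharacterModule.exists_character_apply_ne_zero_of_ne_zero hx'
  refine ⟨c.comp (QuotientAddGroup.mk' B), fun y hy => ?_, hc⟩
  have : QuotientAddGroup.mk' B y = 0 := (QuotientAddGroup.eq_zero_iff y).2 hy
  rw [AddMonoidHom.comp_apply, this, map_zero]

theorem uncountable_character (hG : ¬ AddGroup.FG G) :
    Uncountable (G →+ AddCircle (1 : ℚ)) := by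
  rw [← not_countable_iff]
  intro hc
  obtain ⟨χ, hχ⟩ := exists_surjective_nat (G →+ AddCircle (1 : ℚ))
  have step : ∀ (k : ℕ) (p : AddSubgroup G × (G →+ AddCircle (1 : ℚ))), p.1.FG →
      ∃ q : AddSubgroup G × (G →+ AddCircle (1 : ℚ)), q.1.FG ∧ p.1 ≤ q.1 ∧
        Set.EqOn p.2 q.2 p.1 ∧ ∃ x ∈ q.1, q.2 x ≠ χ k x := by
    rintro k ⟨B, θ⟩ hB
    obtain ⟨x, hx⟩ : ∃ x, x ∉ B := by
      by_contra! h
      refine hG (AddGroup.fg_def.2 ?_)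
      rwa [← (AddSubgroup.eq_top_iff' B).2 h]
    have hfg : (B ⊔ AddSubgroup.closure {x}).FG :=
      hB.sup ((AddSubgroup.fg_iff _).2 ⟨{x}, rfl, by simp⟩)
    have hmem : x ∈ B ⊔ AddSubgroup.closure {x} :=
      (le_sup_right : _ ≤ B ⊔ AddSubgroup.closure {x}) (AddSubgroup.subset_closure rfl)
    by_cases h : θ x = χ k x
    · obtain ⟨ρ, hρ, hρx⟩ := exists_character_vanishing hx
      refine ⟨(_, θ + ρ), hfg, le_sup_left, fun y hy => ?_, x, hmem, ?_⟩
      · simp [hρ y hy]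
      · simpa [h] using hρx
    · exact ⟨(_, θ), hfg, le_sup_left, fun y _ => rfl, x, hmem, h⟩
  choose! f hf hle heq hne using step
  let p : ℕ → AddSubgroup G × (G →+ AddCircle (1 : ℚ)) := fun k => Nat.rec (⊥, 0) f k
  have hp : ∀ k, (p k).1.FG := fun k => by
    induction k with
    | zero => exact AddSubgroup.FG.bot
    | succ k ih => exact hf k _ ih
  have hmono : Monotone fun k => (p k).1 := monotone_nat_of_le_succ fun k => hle k _ (hp k)
  have hcompat : ∀ i j, i ≤ j → Set.EqOn (p i).2 (p j).2 (p i).1 := fun i j hij => by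
    induction j, hij using Nat.le_induction with
    | base => exact fun _ _ => rfl
    | succ j hij ih =>
      exact fun x hx => (ih hx).trans (heq j _ (hp j) (hmono hij hx))
  obtain ⟨F, hF⟩ := exists_character_of_compatible hmono hcompat
  obtain ⟨k, hk⟩ := hχ F
  obtain ⟨x, hx, hxne⟩ := hne k (p k) (hp k)
  exact hxne ((hF (k + 1) hx).symm.trans (by rw [hk]))

/-- A finite rank group which is not finitely generated has infinitely many `ℚ/ℤ`-valued characters
whose pairwise differences do not lift to `ℚ`. -/
theorem exists_seq_character (hG : ¬ AddGroup.FG G) {s : Set G} (hs : s.Finite)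
    (hspan : ∀ x, x ∈ pureClosure s) :
    ∃ χ : ℕ → G →+ AddCircle (1 : ℚ), ∀ m m', m ≠ m' →
      ∀ ψ : G →+ ℚ, ¬ ∀ x, ((ψ x : ℚ) : AddCircle (1 : ℚ)) = χ m x - χ m' x := by
  have hcount : Countable (G →+ ℚ) := by
    have := hs.to_subtype
    refine Function.Injective.countable (f := fun (ψ : G →+ ℚ) (x : s) => ψ x) ?_
    intro ψ ψ' h
    ext x
    exact eqOn_pureClosure (fun y hy => congrFun h ⟨y, hy⟩) (hspan x)
  let r : (G →+ ℚ) →+ (G →+ AddCircle (1 : ℚ)) :=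
    AddMonoidHom.compHom (QuotientAddGroup.mk' (AddSubgroup.zmultiples (1 : ℚ)))
  have hr : Countable r.range := (AddMonoidHom.rangeRestrict_surjective r).countable
  have hunc := uncountable_character hG
  have hinf : Infinite ((G →+ AddCircle (1 : ℚ)) ⧸ r.range) := by
    by_contra hfin
    rw [not_infinite_iff_finite] at hfin
    have : Countable (((G →+ AddCircle (1 : ℚ)) ⧸ r.range) × r.range) := inferInstance
    have : Countable (G →+ AddCircle (1 : ℚ)) :=
      (AddSubgroup.addGroupEquivQuotientProdAddSubgroup (s := r.range)).injective.countable
    exact not_countable this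
  let e := Infinite.natEmbedding ((G →+ AddCircle (1 : ℚ)) ⧸ r.range)
  refine ⟨fun m => (e m).out, fun m m' hmm ψ hψ => hmm (e.injective ?_)⟩
  rw [← (e m).out_eq', ← (e m').out_eq', eq_comm]
  refine QuotientAddGroup.eq.2 ⟨ψ, ?_⟩
  ext x
  exact (hψ x).trans (by simp [sub_eq_neg_add])

/-- Every `ℚ/ℤ`-valued character of a Whitehead group lifts to `ℚ`. -/
theorem IsWhitehead.exists_lift {G : Type u} [AddCommGroup G] (hW : IsWhitehead G)
    (φ : G →+ AddCircle (1 : ℚ)) :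
    ∃ h : G →+ ℚ, ∀ x, ((h x : ℚ) : AddCircle (1 : ℚ)) = φ x := by
  let mk : ℚ →+ AddCircle (1 : ℚ) := QuotientAddGroup.mk' (AddSubgroup.zmultiples (1 : ℚ))
  let H : AddSubgroup (G × ℚ) :=
    (φ.comp (AddMonoidHom.fst G ℚ)).eqLocus (mk.comp (AddMonoidHom.snd G ℚ))
  let π : H →+ G := (AddMonoidHom.fst G ℚ).comp H.subtype
  have hπ : Function.Surjective π := fun x => by
    obtain ⟨q, hq⟩ := QuotientAddGroup.mk_surjective (φ x)
    exact ⟨⟨(x, q), hq.symm⟩, rfl⟩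
  have hker : Nonempty (π.ker ≃+ ℤ) := by
    have hmem : ∀ n : ℤ, ((0, (n : ℚ)) : G × ℚ) ∈ H := fun n => by
      change φ 0 = ((n : ℚ) : AddCircle (1 : ℚ))
      rw [map_zero, eq_comm, AddCircle.coe_eq_zero_iff]
      exact ⟨n, by simp⟩
    let f : ℤ →+ π.ker := AddMonoidHom.mk' (fun n => ⟨⟨(0, (n : ℚ)), hmem n⟩, rfl⟩)
      fun m n => by ext <;> simp
    refine ⟨(AddEquiv.ofBijective f ⟨fun m n h => ?_, ?_⟩).symm⟩
    · simpa [f] using congrArg (fun z : π.ker => (z : H).1.2) h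
    · rintro ⟨⟨⟨x, q⟩, hxq⟩, hx⟩
      obtain rfl : x = 0 := hx
      have hq : φ 0 = ((q : ℚ) : AddCircle (1 : ℚ)) := hxq
      rw [map_zero, eq_comm, AddCircle.coe_eq_zero_iff] at hq
      obtain ⟨n, rfl⟩ := hq
      exact ⟨n, by ext <;> simp [f]⟩
  obtain ⟨s, hs⟩ := hW H π hπ hker
  refine ⟨((AddMonoidHom.snd G ℚ).comp H.subtype).comp s, fun x => ?_⟩
  have h1 : φ (s x : G × ℚ).1 = (((s x : G × ℚ).2 : ℚ) : AddCircle (1 : ℚ)) := (s x).2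
  have h2 : (s x : G × ℚ).1 = x := DFunLike.congr_fun hs x
  rw [h2] at h1
  exact h1.symm

end Characters

section Step

variable {G : Type*} [AddCommGroup G]

theorem exists_step (K : AddSubgroup G) [IsAddTorsionFree (G ⧸ K)] (B : AddSubgroup (G ⧸ K))
    [Countable B] (hB : ¬ Module.Free ℤ B) :
    ∃ (s : Set G) (L : AddSubgroup G) (χ : ℕ → G →+ AddCircle (1 : ℚ)),
      s.Finite ∧ K ≤ L ∧ L ≤ pureClosure (K ∪ s) ∧ (∀ m, ∀ x ∈ K, χ m x = 0) ∧
      ∀ m m', m ≠ m' → ∀ ψ : G →+ ℚ, (∀ x ∈ K, ψ x = 0) →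
        ¬ ∀ x ∈ L, ((ψ x : ℚ) : AddCircle (1 : ℚ)) = χ m x - χ m' x := by
  obtain ⟨t, A, ht, hA, htA, hAt⟩ := exists_finiteRank_not_fg B hB
  let q := QuotientAddGroup.mk' K
  have hq : Function.Surjective q := QuotientAddGroup.mk'_surjective K
  have hq0 : ∀ x ∈ K, q x = 0 := fun x hx => (QuotientAddGroup.eq_zero_iff x).2 hx
  obtain ⟨s, hst, hs⟩ : ∃ s : Set G, q '' s = t ∧ s.Finite := by
    refine ⟨Function.surjInv hq '' t, ?_, ht.image _⟩
    rw [Set.image_image]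
    simp [Function.surjInv_eq hq]
  have hA' : ¬ AddGroup.FG A := fun h => hA ((AddGroup.fg_iff_addSubgroup_fg A).1 h)
  have hspan : ∀ x : A, x ∈ pureClosure (((↑) : A → G ⧸ K) ⁻¹' t) := by
    intro x
    obtain ⟨n, hn, hx⟩ := hAt x.2
    refine ⟨n, hn, ?_⟩
    have himage : A.subtype '' (((↑) : A → G ⧸ K) ⁻¹' t) = t :=
      Set.image_preimage_eq_of_subset (by simpa using htA)
    rw [← himage, ← AddMonoidHom.map_closure] at hx
    obtain ⟨y, hy, hyx⟩ := hx
    rwa [← show y = n • x from Subtype.ext hyx]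
  obtain ⟨χ, hχ⟩ := exists_seq_character hA' (ht.preimage Subtype.val_injective.injOn) hspan
  choose F hF using fun m => exists_character_extension A (χ m)
  refine ⟨s, A.comap q, fun m => (F m).comp q, hs, fun x hx => ?_, fun x hx => ?_,
    fun m x hx => ?_, fun m m' hm ψ hψ h => ?_⟩
  · rw [AddSubgroup.mem_comap, hq0 x hx]
    exact zero_mem A
  · obtain ⟨n, hn, hx'⟩ := hAt hx
    refine ⟨n, hn, ?_⟩
    rw [← hst, ← AddMonoidHom.map_closure] at hx'
    obtain ⟨y, hy, hyx⟩ := hx'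
    have hxy : n • x - y ∈ K := by
      rw [← QuotientAddGroup.eq_zero_iff]
      change q (n • x - y) = 0
      rw [map_sub, map_zsmul, hyx, sub_self]
    rw [← sub_add_cancel (n • x) y]
    exact add_mem (AddSubgroup.subset_closure (Or.inl hxy))
      (AddSubgroup.closure_mono Set.subset_union_right hy)
  · rw [AddMonoidHom.comp_apply, hq0 x hx, map_zero]
  · refine hχ m m' hm ((QuotientAddGroup.lift K ψ hψ).comp A.subtype) fun x => ?_
    obtain ⟨y, hy⟩ := hq x
    have := h y (by rw [AddSubgroup.mem_comap, hy]; exact x.2)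
    rw [AddMonoidHom.comp_apply, AddMonoidHom.comp_apply, hy, hF, hF] at this
    rw [← this, AddMonoidHom.comp_apply, AddSubgroup.subtype_apply, ← hy]
    rfl

/-- Along a well-ordered chain of subgroups, a character can be prescribed on each `L i` as a
function of its restriction to `P i`. -/
theorem exists_character_eqOn_of_chain {I : Type*} [LinearOrder I] [WellFoundedLT I]
    {P L : I → AddSubgroup G} (hPL : ∀ i, P i ≤ L i) (hLP : ∀ i j, j < i → L j ≤ P i)
    (T : I → (G →+ AddCircle (1 : ℚ)) → G →+ AddCircle (1 : ℚ))
    (hT : ∀ i (f : G →+ AddCircle (1 : ℚ)), Set.EqOn (T i f) f (P i))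
    (hT' : ∀ i (f f' : G →+ AddCircle (1 : ℚ)), Set.EqOn f f' (P i) → T i f = T i f') :
    ∃ φ : G →+ AddCircle (1 : ℚ), ∀ i, Set.EqOn φ (T i φ) (L i) := by
  classical
  have hL : Monotone L := fun i j hij => by
    rcases hij.eq_or_lt with rfl | h
    · exact le_rfl
    · exact (hLP j i h).trans (hPL j)
  let step : (i : I) → ((j : I) → j < i → G →+ AddCircle (1 : ℚ)) → G →+ AddCircle (1 : ℚ) :=
    fun i r => if h : ∃ f : G →+ AddCircle (1 : ℚ), ∀ j hj, Set.EqOn f (r j hj) (L j)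
      then T i h.choose else 0
  let θ : I → G →+ AddCircle (1 : ℚ) := wellFounded_lt.fix step
  have hθ : ∀ i, ∃ f : G →+ AddCircle (1 : ℚ), (∀ j < i, Set.EqOn f (θ j) (L j)) ∧ θ i = T i f := by
    intro i
    induction i using WellFoundedLT.induction with
    | ind i ih =>
      have hex : ∃ f : G →+ AddCircle (1 : ℚ), ∀ j < i, Set.EqOn f (θ j) (L j) := by
        obtain ⟨F, hF⟩ := exists_character_of_compatible (ι := Set.Iio i) (B := fun j => L j)
          (θ := fun j => θ j) (fun j k hjk => hL hjk) (by
            rintro ⟨j, hj⟩ ⟨k, hk⟩ hjk x hx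
            rcases (Subtype.mk_le_mk.1 hjk).eq_or_lt with rfl | h
            · rfl
            · obtain ⟨f, hf, hfk⟩ := ih k hk
              change θ j x = θ k x
              rw [hfk, hT k f (hLP k j h hx), hf j h hx])
        exact ⟨F, fun j hj => hF ⟨j, hj⟩⟩
      refine ⟨hex.choose, hex.choose_spec, ?_⟩
      have : θ i = step i fun j _ => θ j := wellFounded_lt.fix_eq step i
      rw [this]
      exact dif_pos hex
  have hcompat : ∀ i j, i ≤ j → Set.EqOn (θ i) (θ j) (L i) := by
    intro i j hij x hx
    rcases hij.eq_or_lt with rfl | h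
    · rfl
    · obtain ⟨f, hf, hfj⟩ := hθ j
      rw [hfj, hT j f (hLP j i h hx), hf i h hx]
  obtain ⟨φ, hφ⟩ := exists_character_of_compatible hL hcompat
  refine ⟨φ, fun i x hx => ?_⟩
  obtain ⟨f, -, hfi⟩ := hθ i
  rw [hφ i hx, hfi]
  refine DFunLike.congr_fun (hT' i _ _ fun y hy => ?_) x
  rw [hφ i (hPL i hy), hfi, hT i f hy]

end Step

/-- Let the Whitehead group `G` contain a well-ordered chain of pure subgroups starting at `H`, each
step `P i ≤ L i` having finite rank and carrying infinitely many characters with non-liftable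
differences. Then functions `I → ℕ` are coded by sequences of functions `H → ℚ`. -/
theorem IsWhitehead.exists_injective {G : Type u} [AddCommGroup G] (hW : IsWhitehead G)
    {I : Type*} [LinearOrder I] [WellFoundedLT I] {H : Set G} {s : I → Set G}
    {P L : I → AddSubgroup G} {χ : I → ℕ → G →+ AddCircle (1 : ℚ)}
    (hs : ∀ i, (s i).Finite) (hP : ∀ i, P i = pureClosure (H ∪ ⋃ j : Set.Iio i, L j))
    (hPL : ∀ i, P i ≤ L i) (hL : ∀ i, L i ≤ pureClosure (P i ∪ s i))
    (hχ0 : ∀ i m, ∀ x ∈ P i, χ i m x = 0)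
    (hχ : ∀ i m m', m ≠ m' → ∀ ψ : G →+ ℚ, (∀ x ∈ P i, ψ x = 0) →
      ¬ ∀ x ∈ L i, ((ψ x : ℚ) : AddCircle (1 : ℚ)) = χ i m x - χ i m' x) :
    ∃ Φ : (I → ℕ) → ℕ → H → ℚ, Function.Injective Φ := by
  have hLP : ∀ i j, j < i → L j ≤ P i := fun i j hj x hx => by
    rw [hP]
    exact subset_pureClosure _ (Or.inr (Set.mem_iUnion.2 ⟨⟨j, hj⟩, hx⟩))
  choose E hE using fun i => exists_character_extension (P i)
  have hlift : ∀ g : I → ℕ, ∃ h : G →+ ℚ, ∃ φ : G →+ AddCircle (1 : ℚ),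
      (∀ x, ((h x : ℚ) : AddCircle (1 : ℚ)) = φ x) ∧
      ∀ i, Set.EqOn φ (E i (φ.comp (P i).subtype) + χ i (g i)) (L i) := fun g => by
    obtain ⟨φ, hφ⟩ := exists_character_eqOn_of_chain hPL hLP
      (fun i f => E i (f.comp (P i).subtype) + χ i (g i))
      (fun i f x hx => by
        have := hE i (f.comp (P i).subtype) ⟨x, hx⟩
        simpa [hχ0 i _ x hx] using this)
      (fun i f f' hff => by
        have : f.comp (P i).subtype = f'.comp (P i).subtype := by
          ext x
          exact hff x.2
        simp only [this])
    obtain ⟨h, hh⟩ := hW.exists_lift φ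
    exact ⟨h, φ, hh, hφ⟩
  choose h φ hφ hφE using hlift
  have hdecode : ∀ g g' i, Set.EqOn (h g) (h g') (P i) → g i = g' i := by
    intro g g' i hgg
    by_contra hne
    refine hχ i _ _ hne (h g - h g') (fun x hx => ?_) fun x hx => ?_
    · rw [AddMonoidHom.sub_apply, hgg hx, sub_self]
    · have hres : (φ g).comp (P i).subtype = (φ g').comp (P i).subtype := by
        ext x
        change φ g x = φ g' x
        rw [← hφ, ← hφ, hgg x.2]
      rw [AddMonoidHom.sub_apply, AddCircle.coe_sub, hφ, hφ, hφE g i hx, hφE g' i hx, hres]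
      simp
  have hcode : ∀ i, ∃ c : (G →+ ℚ) → ℕ, ∀ f f', c f = c f' → Set.EqOn f f' (s i) := fun i => by
    have := (hs i).to_subtype
    obtain ⟨e, he⟩ := exists_injective_nat (s i → ℚ)
    exact ⟨fun f => e fun x => f x, fun f f' hff x hx => congrFun (he hff) ⟨x, hx⟩⟩
  choose c hc using hcode
  let F : (I → ℕ) → ℕ → G →+ ℚ := fun g n => Nat.rec (h g) (fun _ f => h fun i => c i f) n
  refine ⟨fun g n x => F g n x, fun g g' hgg => ?_⟩
  have key : ∀ i n, Set.EqOn (F g n) (F g' n) (P i) := by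
    intro i
    induction i using WellFoundedLT.induction with
    | ind i ih =>
      intro n
      rw [hP]
      refine eqOn_pureClosure (Set.EqOn.union ?_ ?_)
      · exact fun x hx => congrFun (congrFun hgg n) ⟨x, hx⟩
      · intro x hx
        obtain ⟨⟨j, hj⟩, hx⟩ := Set.mem_iUnion.1 hx
        have hcj : c j (F g n) = c j (F g' n) := hdecode _ _ j (ih j hj (n + 1))
        exact eqOn_pureClosure ((ih j hj n).union (hc j _ _ hcj)) (hL j hx)
  exact funext fun i => hdecode _ _ i (key i 0)

/-- A non-free group of size below the least uncountable cardinal carrying an almost free non-free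
group has a countable non-free subgroup. -/
theorem exists_countable_not_free {κ : Cardinal.{u}}
    (hleast : ∀ lam : Cardinal.{u},
      Cardinal.aleph0 < lam ∧ ExistsAlmostFreeNonfree lam → κ ≤ lam)
    (A : Type u) [AddCommGroup A] (hA : Cardinal.mk A < κ) (hfree : ¬ Module.Free ℤ A) :
    ∃ B : AddSubgroup A, Countable B ∧ ¬ Module.Free ℤ B := by
  induction hc : Cardinal.mk A using WellFoundedLT.induction generalizing A with
  | ind c ih =>
    subst hc
    rcases le_or_gt (Cardinal.mk A) Cardinal.aleph0 with h | h
    · have := Cardinal.mk_le_aleph0_iff.1 h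
      refine ⟨⊤, inferInstance, fun _ => hfree ?_⟩
      exact Module.Free.of_equiv (AddSubgroup.topEquiv (G := A)).toIntLinearEquiv
    · have hnot : ¬ IsKappaFree (Cardinal.mk A) A := fun hk =>
        (hleast _ ⟨h, A, inferInstance, rfl, hk, hfree⟩).not_gt hA
      simp only [IsKappaFree, not_forall] at hnot
      obtain ⟨C, hC, hCfree⟩ := hnot
      obtain ⟨B, hB, hBfree⟩ := ih _ hC C (hC.trans hA) hCfree rfl
      let e := B.equivMapOfInjective C.subtype C.subtype_injective
      refine ⟨B.map C.subtype, e.symm.injective.countable, fun _ => hBfree ?_⟩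
      exact Module.Free.of_equiv e.symm.toIntLinearEquiv

theorem IsKappaFree.isAddTorsionFree {κ : Cardinal.{u}} (hκ : Cardinal.aleph0 < κ) {G : Type u}
    [AddCommGroup G] (hG : IsKappaFree κ G) : IsAddTorsionFree G := by
  rw [← Module.isTorsionFree_int_iff_isAddTorsionFree]
  refine .of_smul_eq_zero fun n x h => ?_
  have : Countable (AddSubgroup.zmultiples x) :=
    (Set.countable_range fun n : ℤ => n • x).to_subtype
  have hfree : Module.Free ℤ (AddSubgroup.zmultiples x) := hG _ (Cardinal.mk_le_aleph0.trans_lt hκ)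
  have h' : n • (⟨x, AddSubgroup.mem_zmultiples x⟩ : AddSubgroup.zmultiples x) = 0 :=
    Subtype.ext h
  rcases smul_eq_zero.1 h' with h0 | h0
  · exact Or.inl h0
  · exact Or.inr (congrArg Subtype.val h0)

theorem stmt6
    (gch : ∀ μ : Cardinal.{u}, Cardinal.aleph0 ≤ μ → (2 : Cardinal.{u}) ^ μ = Order.succ μ)
    (μ κ : Cardinal.{u}) (hsucc : κ = Order.succ μ)
    (hκ : Cardinal.aleph0 < κ ∧ ExistsAlmostFreeNonfree κ)
    (hleast : ∀ lam : Cardinal.{u},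
      Cardinal.aleph0 < lam ∧ ExistsAlmostFreeNonfree lam → κ ≤ lam)
    (G : Type u) [AddCommGroup G] (hcard : Cardinal.mk G = κ)
    (hfree : IsKappaFree κ G) (hW : IsWhitehead G) :
    IsStronglyKappaFree κ G := by
  refine ⟨hfree, ?_⟩
  by_contra! hcon
  obtain ⟨H, hH, hHK⟩ := hcon
  have htf := hfree.isAddTorsionFree hκ.1
  have hlt : ∀ {c : Cardinal.{u}}, c < κ ↔ c ≤ μ := by
    intro c
    rw [hsucc, Order.lt_succ_iff]
  have hμ : Cardinal.aleph0 ≤ μ := hlt.1 hκ.1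
  have hstep : ∀ K : AddSubgroup G, H ≤ K ∧ Cardinal.mk K ≤ μ ∧ IsAddTorsionFree (G ⧸ K) →
      ∃ (s : Set G) (L : AddSubgroup G) (χ : ℕ → G →+ AddCircle (1 : ℚ)),
        s.Finite ∧ K ≤ L ∧ L ≤ pureClosure (K ∪ s) ∧ (∀ m, ∀ x ∈ K, χ m x = 0) ∧
        ∀ m m', m ≠ m' → ∀ ψ : G →+ ℚ, (∀ x ∈ K, ψ x = 0) →
          ¬ ∀ x ∈ L, ((ψ x : ℚ) : AddCircle (1 : ℚ)) = χ m x - χ m' x := by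
    rintro K ⟨hK, hKμ, hKtf⟩
    have hnot := hHK K hK (hlt.2 hKμ)
    simp only [IsKappaFree, not_forall] at hnot
    obtain ⟨A, hA, hAfree⟩ := hnot
    obtain ⟨B, hB, hBfree⟩ := exists_countable_not_free hleast A hA hAfree
    let e := B.equivMapOfInjective A.subtype A.subtype_injective
    have : Countable (B.map A.subtype) := e.symm.injective.countable
    exact exists_step K (B.map A.subtype) fun _ =>
      hBfree (Module.Free.of_equiv e.symm.toIntLinearEquiv)
  choose! s next χ hs hle hnext hχ0 hχ using hstep
  let I := κ.ord.ToType
  let L : I → AddSubgroup G := wellFounded_lt.fix fun i r =>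
    next (pureClosure (H ∪ ⋃ j : Set.Iio i, (r j j.2 : Set G)))
  let P : I → AddSubgroup G := fun i => pureClosure (H ∪ ⋃ j : Set.Iio i, (L j : Set G))
  have hLP : ∀ i, L i = next (P i) := fun i => wellFounded_lt.fix_eq _ i
  have hP : ∀ i, H ≤ P i ∧ Cardinal.mk (P i) ≤ μ ∧ IsAddTorsionFree (G ⧸ P i) := by
    intro i
    induction i using WellFoundedLT.induction with
    | ind i ih =>
      refine ⟨fun x hx => subset_pureClosure _ (Or.inl hx), ?_,
        isAddTorsionFree_quotient_pureClosure _⟩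
      refine (mk_pureClosure_le _).trans (max_le ?_ hμ)
      refine (Cardinal.mk_union_le _ _).trans (Cardinal.add_le_of_le hμ (hlt.1 hH) ?_)
      refine Cardinal.mk_iUnion_le_sum_mk.trans ((Cardinal.sum_le_sum _ (fun _ => μ) ?_).trans ?_)
      · rintro ⟨j, hj⟩
        change Cardinal.mk (L j) ≤ μ
        rw [hLP]
        refine (Cardinal.mk_le_mk_of_subset (hnext _ (ih j hj))).trans
          ((mk_pureClosure_le _).trans (max_le ?_ hμ))
        exact (Cardinal.mk_union_le _ _).trans (Cardinal.add_le_of_le hμ (ih j hj).2.1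
          ((hs _ (ih j hj)).lt_aleph0.le.trans hμ))
      · rw [Cardinal.sum_const']
        refine Cardinal.mul_le_of_le hμ (hlt.1 ?_) le_rfl
        simpa [I] using Cardinal.mk_Iio_lt i (by simp [I])
  obtain ⟨Φ, hΦ⟩ := hW.exists_injective (H := H) (s := fun i => s (P i)) (P := P) (L := L)
    (χ := fun i => χ (P i)) (fun i => hs _ (hP i)) (fun i => rfl)
    (fun i => by rw [hLP]; exact hle _ (hP i)) (fun i => by rw [hLP]; exact hnext _ (hP i))
    (fun i => hχ0 _ (hP i)) (fun i => by rw [hLP]; exact hχ _ (hP i))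
  have hcount := Cardinal.mk_le_of_injective hΦ
  have hle1 : Cardinal.mk (ℕ → H → ℚ) ≤ κ := by
    have h1 : Cardinal.mk (ℕ → H → ℚ) = (Cardinal.aleph0 ^ Cardinal.mk H) ^ Cardinal.aleph0 := by
      simp
    rw [h1, ← Cardinal.power_mul, hsucc, ← gch μ hμ, ← Cardinal.power_self_eq hμ]
    exact (Cardinal.power_le_power_left Cardinal.aleph0_ne_zero
      (Cardinal.mul_le_of_le hμ (hlt.1 hH) hμ)).trans (Cardinal.power_le_power_right hμ)
  have hle2 : κ < Cardinal.mk (I → ℕ) := by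
    have h1 : Cardinal.mk (I → ℕ) = Cardinal.aleph0 ^ κ := by
      simp [I]
    rw [h1]
    exact (Cardinal.cantor κ).trans_le
      (Cardinal.power_le_power_right Cardinal.natCast_lt_aleph0.le)
  exact (hle2.trans_le (hcount.trans hle1)).false
end

section
/- Every Whitehead abelian group is ℵ₁-free, i.e., every countable subgroup of a Whitehead group is free. -/
universe u

/-- Every homomorphism to `ℚ / ℤ` lifts to `ℚ`; equivalently, `Ext¹(A, ℤ) = 0`. -/
def LiftsCharacters (A : Type*) [AddCommGroup A] : Prop :=
  ∀ f : A →+ AddCircle (1 : ℚ), ∃ g : A →+ ℚ, ∀ a, (g a : AddCircle (1 : ℚ)) = f a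

theorem IsWhitehead.liftsCharacters {G : Type u} [AddCommGroup G] (hW : IsWhitehead G) :
    LiftsCharacters G := by
  intro f
  let q : ℚ →+ AddCircle (1 : ℚ) := QuotientAddGroup.mk' _
  let P : AddSubgroup (ℚ × G) :=
    (q.comp (AddMonoidHom.fst ℚ G) - f.comp (AddMonoidHom.snd ℚ G)).ker
  have hP : ∀ x : ℚ × G, x ∈ P ↔ q x.1 = f x.2 := fun x ↦ by
    simp [P, AddMonoidHom.mem_ker, sub_eq_zero]
  let π : P →+ G := (AddMonoidHom.snd ℚ G).comp P.subtype
  have hπ : Function.Surjective π := by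
    intro g
    obtain ⟨r, hr⟩ := QuotientAddGroup.mk'_surjective _ (f g)
    exact ⟨⟨(r, g), (hP _).2 hr⟩, rfl⟩
  have hq : ∀ n : ℤ, q n = 0 := fun n ↦ AddCircle.coe_eq_zero_iff (1 : ℚ) |>.2 ⟨n, by simp⟩
  let i : ℤ →+ π.ker :=
    { toFun := fun n ↦ ⟨⟨((n : ℚ), 0), (hP _).2 (by simpa using hq n)⟩, rfl⟩
      map_zero' := by ext <;> simp
      map_add' := fun a b ↦ by ext <;> simp }
  have hi : Function.Bijective i := by
    refine ⟨fun a b h ↦ ?_, fun ⟨⟨⟨r, g⟩, hx⟩, hg⟩ ↦ ?_⟩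
    · have : (a : ℚ) = b := congrArg (fun z : π.ker ↦ z.1.1.1) h
      exact_mod_cast this
    · have hg : g = 0 := hg
      subst hg
      have hr : q r = 0 := by simpa using (hP _).1 hx
      obtain ⟨n, hn⟩ := (AddCircle.coe_eq_zero_iff (1 : ℚ)).1 hr
      refine ⟨n, ?_⟩
      ext
      · simpa [i] using hn
      · rfl
  obtain ⟨s, hs⟩ := hW P π hπ ⟨(AddEquiv.ofBijective i hi).symm⟩
  refine ⟨(AddMonoidHom.fst ℚ G).comp (P.subtype.comp s), fun a ↦ ?_⟩
  have h1 : ((s a : P) : ℚ × G).2 = a := DFunLike.congr_fun hs a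
  have h2 := (hP _).1 (s a).2
  rw [h1] at h2
  exact h2

theorem LiftsCharacters.of_injective {A B : Type*} [AddCommGroup A] [AddCommGroup B]
    (hB : LiftsCharacters B) (i : A →+ B) (hi : Function.Injective i) : LiftsCharacters A := by
  intro f
  obtain ⟨f', hf'⟩ := CharacterModule.dual_surjective_of_injective i.toIntLinearMap hi f
  obtain ⟨g, hg⟩ := hB f'
  exact ⟨g.comp i, fun a ↦ (hg (i a)).trans (DFunLike.congr_fun hf' a)⟩

theorem LiftsCharacters.isTorsionFree {A : Type*} [AddCommGroup A] (hA : LiftsCharacters A) :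
    Module.IsTorsionFree ℤ A := by
  refine Module.IsTorsionFree.of_smul_eq_zero fun n a h ↦ ?_
  by_contra! hna
  obtain ⟨c, hc⟩ := CharacterModule.exists_character_apply_ne_zero_of_ne_zero hna.2
  obtain ⟨g, hg⟩ := hA c
  have hga : n * g a = 0 := by
    rw [← zsmul_eq_mul, ← map_zsmul, h, map_zero]
  have : g a = 0 := by simpa [hna.1] using hga
  exact hc ((hg a).symm.trans (by simp [this]))

/-- A countable abelian group with only countably many characters is finitely generated. -/
theorem Module.Finite.of_countable_characterModule (A : Type*) [AddCommGroup A] [Countable A]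
    [Countable (CharacterModule A)] : Module.Finite ℤ A := by
  obtain ⟨e, he⟩ := exists_surjective_nat A
  let T : ℕ → Submodule ℤ A := fun n ↦ Submodule.span ℤ (e '' Set.Iio n)
  have heT : ∀ {m n}, m < n → e m ∈ T n := fun h ↦ Submodule.subset_span ⟨_, h, rfl⟩
  let S : Set ℕ := {n | e n ∉ T n}
  have hθ : ∀ n, ∃ θ : A →+ AddCircle (1 : ℚ),
      (∀ x ∈ T n, θ x = 0) ∧ (n ∈ S → θ (e n) ≠ 0) := by
    intro n
    by_cases hn : n ∈ S
    · have : (T n).mkQ (e n) ≠ 0 := by simpa [S] using hn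
      obtain ⟨c, hc⟩ := CharacterModule.exists_character_apply_ne_zero_of_ne_zero this
      refine ⟨AddMonoidHom.comp c (T n).mkQ.toAddMonoidHom, fun x hx ↦ ?_, fun _ ↦ hc⟩
      have : (T n).mkQ x = 0 := by simpa using hx
      change c ((T n).mkQ x) = 0
      rw [this, map_zero]
    · exact ⟨0, fun _ _ ↦ rfl, fun h ↦ (hn h).elim⟩
  choose θ hθT hθe using hθ
  have hsupp : ∀ (U : Set ℕ) (x : A),
      (Function.support (U.indicator fun n ↦ θ n x)).Finite := by
    intro U x
    obtain ⟨m, rfl⟩ := he x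
    refine (Set.finite_Iic m).subset fun n hn ↦ ?_
    by_contra! hmn
    apply hn
    have : θ n (e m) = 0 := hθT n _ (heT (by simpa using hmn))
    simp [this]
  let Ψ : Set ℕ → CharacterModule A := fun U ↦
    ({  toFun := fun x ↦ ∑ᶠ n, U.indicator (fun n ↦ θ n x) n
        map_zero' := by simp
        map_add' := fun x y ↦ by
          rw [← finsum_add_distrib (hsupp U x) (hsupp U y)]
          refine finsum_congr fun n ↦ ?_
          by_cases hn : n ∈ U <;> simp [hn] } : A →+ AddCircle (1 : ℚ))
  have hΨ : ∀ U V : Set ℕ, U ⊆ S → V ⊆ S → Ψ U = Ψ V → U = V := by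
    intro U V hU hV h
    ext n
    induction n using Nat.strong_induction_on with
    | _ n ih =>
    by_cases hn : n ∈ S
    · have h1 : ∑ᶠ m, (U.indicator (fun m ↦ θ m (e n)) m - V.indicator (fun m ↦ θ m (e n)) m)
          = 0 := by
        rw [finsum_sub_distrib (hsupp U _) (hsupp V _), sub_eq_zero]
        exact DFunLike.congr_fun h (e n)
      rw [finsum_eq_single _ n] at h1
      · have := hθe n hn
        by_cases hnU : n ∈ U <;> by_cases hnV : n ∈ V <;> simp_all
      · intro m hm
        rcases lt_or_gt_of_ne hm with hm | hm
        · by_cases hmV : m ∈ V <;> simp [ih m hm, hmV]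
        · have : θ m (e n) = 0 := hθT m _ (heT hm)
          by_cases hmU : m ∈ U <;> by_cases hmV : m ∈ V <;> simp [hmU, hmV, this]
    · exact ⟨fun h ↦ (hn (hU h)).elim, fun h ↦ (hn (hV h)).elim⟩
  have hSfin : S.Finite := by
    by_contra hS
    have : Infinite S := Set.infinite_coe_iff.2 hS
    have hinj : Function.Injective fun U : Set S ↦ Ψ (Subtype.val '' U) := fun U V h ↦
      Set.image_injective.2 Subtype.val_injective (hΨ _ _ (by simp) (by simp) h)
    have : Countable (Set S) := hinj.countable
    obtain ⟨f, hf⟩ := exists_injective_nat (Set S)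
    exact Function.cantor_injective _ ((Infinite.natEmbedding S).injective.comp hf)
  obtain ⟨N, hN⟩ := hSfin.bddAbove
  have hT : ∀ n, e n ∈ T (N + 1) := by
    intro n
    induction n using Nat.strong_induction_on with
    | _ n ih =>
    by_cases hn : n ∈ S
    · exact heT (Nat.lt_succ_of_le (hN hn))
    · refine Submodule.span_le.2 ?_ (not_not.1 hn)
      rintro _ ⟨m, hm, rfl⟩
      exact ih m hm
  refine ⟨⟨((Set.finite_Iio (N + 1)).image e).toFinset, ?_⟩⟩
  rw [Set.Finite.coe_toFinset, eq_top_iff]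
  rintro x -
  obtain ⟨n, rfl⟩ := he x
  exact hT n

theorem LiftsCharacters.finite {A : Type*} [AddCommGroup A] [Countable A]
    (hA : LiftsCharacters A) {s : Set A} (hs : s.Finite)
    (htors : ∀ a : A, ∃ k : ℤ, k ≠ 0 ∧ k • a ∈ Submodule.span ℤ s) : Module.Finite ℤ A := by
  let F := Submodule.span ℤ s
  have : Finite s := hs
  have hlift : ∀ c : CharacterModule (A ⧸ F), ∃ g : A →+ ℚ,
      ∀ a, (g a : AddCircle (1 : ℚ)) = c (F.mkQ a) := fun c ↦
    hA (AddMonoidHom.comp c F.mkQ.toAddMonoidHom)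
  choose g hg using hlift
  have hinj : Function.Injective fun c (a : s) ↦ g c a := by
    intro c d h
    have hF : ∀ x ∈ F, g c x = g d x := fun x hx ↦
      LinearMap.eqOn_span (f := (g c).toIntLinearMap) (g := (g d).toIntLinearMap)
        (fun a ha ↦ congrFun h ⟨a, ha⟩) hx
    refine DFunLike.ext _ _ fun x ↦ ?_
    obtain ⟨a, rfl⟩ := F.mkQ_surjective x
    obtain ⟨k, hk, hka⟩ := htors a
    have := hF _ hka
    rw [map_zsmul, map_zsmul] at this
    rw [← hg, ← hg, smul_right_injective ℚ hk this]
  have : Countable (CharacterModule (A ⧸ F)) := hinj.countable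
  have : Countable (A ⧸ F) := F.mkQ_surjective.countable
  have : Module.Finite ℤ (A ⧸ F) := .of_countable_characterModule _
  have : Module.Finite ℤ F := Module.Finite.span_of_finite ℤ hs
  exact Module.Finite.of_submodule_quotient F

theorem Submodule.exists_disjoint_sup_eq_of_isTorsionFree_quotient {R M : Type*} [CommRing R]
    [IsDomain R] [IsPrincipalIdealRing R] [AddCommGroup M] [Module R M] {N P : Submodule R M}
    (hNP : N ≤ P) (hP : P.FG) [Module.IsTorsionFree R (M ⧸ N)] :
    ∃ C : Submodule R M, Disjoint N C ∧ N ⊔ C = P := by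
  have : Module.Finite R P := Module.Finite.iff_fg.2 hP
  let f : P →ₗ[R] M ⧸ N := N.mkQ ∘ₗ P.subtype
  obtain ⟨s, hs⟩ := Module.projective_lifting_property f.rangeRestrict .id
    f.surjective_rangeRestrict
  have hs' : ∀ x, N.mkQ (s x) = x := fun x ↦ congrArg Subtype.val (LinearMap.congr_fun hs x)
  refine ⟨LinearMap.range (P.subtype ∘ₗ s), ?_, le_antisymm (sup_le hNP ?_) fun x hx ↦ ?_⟩
  · rw [Submodule.disjoint_def]
    rintro _ hx ⟨y, rfl⟩
    have : y = 0 := by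
      ext
      rw [← hs' y]
      simpa using hx
    simp [this]
  · rintro _ ⟨y, rfl⟩
    exact (s y).2
  · let y := f.rangeRestrict ⟨x, hx⟩
    refine Submodule.mem_sup.2 ⟨x - s y, ?_, s y, ⟨y, rfl⟩, by simp⟩
    rw [← Submodule.Quotient.mk_eq_zero, ← Submodule.mkQ_apply, map_sub, hs', sub_eq_zero]
    rfl

theorem iSupIndep_of_disjoint_of_le_succ {R M : Type*} [Ring R] [AddCommGroup M] [Module R M]
    {P C : ℕ → Submodule R M} (hP : Monotone P) (hC : ∀ n, C n ≤ P (n + 1))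
    (hd : ∀ n, Disjoint (P n) (C n)) : iSupIndep C := by
  classical
  refine iSupIndep_of_dfinsupp_lsum_injective _ ?_
  rw [← LinearMap.ker_eq_bot, LinearMap.ker_eq_bot']
  intro x hx
  by_contra hne
  have hsupp : x.support.Nonempty := by simpa [Finset.nonempty_iff_ne_empty] using hne
  let m := x.support.max' hsupp
  have hm : m ∈ x.support := x.support.max'_mem hsupp
  rw [DFinsupp.lsum_apply_apply, DFinsupp.sumAddHom_apply, DFinsupp.sum,
    ← Finset.add_sum_erase _ _ hm] at hx
  change (x m : M) + ∑ i ∈ x.support.erase m, (x i : M) = 0 at hx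
  have h1 : ∑ i ∈ x.support.erase m, (x i : M) ∈ P m := Submodule.sum_mem _ fun i hi ↦ by
    have hlt : i < m := lt_of_le_of_ne (x.support.le_max' i (Finset.mem_of_mem_erase hi))
      (Finset.ne_of_mem_erase hi)
    exact hP hlt (hC i (x i).2)
  have h2 : (x m : M) ∈ P m := by
    rw [eq_neg_of_add_eq_zero_left hx]
    exact neg_mem h1
  have h3 := (Submodule.disjoint_def.1 (hd m)) _ h2 (x m).2
  exact (DFinsupp.mem_support_iff.1 hm) (Subtype.ext h3)

theorem Module.Free.of_iSupIndep {ι R M : Type*} [Ring R] [AddCommGroup M] [Module R M]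
    {C : ι → Submodule R M} [∀ i, Module.Free R (C i)] (h : iSupIndep C) (htop : iSup C = ⊤) :
    Module.Free R M := by
  classical
  have hC := DirectSum.isInternal_submodule_of_iSupIndep_of_iSup_eq_top h htop
  exact .of_basis <| hC.collectedBasis fun i ↦ Module.Free.chooseBasis R (C i)

theorem LiftsCharacters.free {A : Type*} [AddCommGroup A] [Countable A]
    (hA : LiftsCharacters A) : Module.Free ℤ A := by
  have := hA.isTorsionFree
  obtain ⟨e, he⟩ := exists_surjective_nat A
  let F : ℕ → Submodule ℤ A := fun n ↦ Submodule.span ℤ (e '' Set.Iio n)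
  let P : ℕ → Submodule ℤ A := fun n ↦ (Submodule.torsion ℤ (A ⧸ F n)).comap (F n).mkQ
  have hmem : ∀ n x, x ∈ P n ↔ ∃ k : ℤ, k ≠ 0 ∧ k • x ∈ F n := by
    intro n x
    rw [Submodule.mem_comap, Submodule.mem_torsion_iff]
    simp only [← Submodule.Quotient.mk_eq_zero]
    exact ⟨fun ⟨k, hk⟩ ↦ ⟨k, nonZeroDivisors.ne_zero k.2, hk⟩,
      fun ⟨k, hk, h⟩ ↦ ⟨⟨k, mem_nonZeroDivisors_of_ne_zero hk⟩, h⟩⟩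
  have hFP : ∀ n, F n ≤ P n := fun n x hx ↦ (hmem n x).2 ⟨1, one_ne_zero, by simpa⟩
  have hF : Monotone F := fun m n h ↦
    Submodule.span_mono (Set.image_mono (Set.Iio_subset_Iio h))
  have hP : Monotone P := fun m n h x hx ↦ by
    obtain ⟨k, hk, hkx⟩ := (hmem m x).1 hx
    exact (hmem n x).2 ⟨k, hk, hF h hkx⟩
  have hfg : ∀ n, (P n).FG := by
    intro n
    rw [← Module.Finite.iff_fg]
    have hfin : ((P n).subtype ⁻¹' (e '' Set.Iio n)).Finite :=
      ((Set.finite_Iio n).image e).preimage (P n).subtype_injective.injOn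
    refine (hA.of_injective (P n).subtype.toAddMonoidHom (P n).subtype_injective).finite
      hfin fun a ↦ ?_
    obtain ⟨k, hk, hka⟩ := (hmem n a).1 a.2
    refine ⟨k, hk, ?_⟩
    have hsub : e '' Set.Iio n ⊆ P n := Submodule.subset_span.trans (hFP n)
    change _ ∈ Submodule.span ℤ _ at hka
    rw [← Set.image_preimage_eq_of_subset (s := e '' Set.Iio n) (f := (P n).subtype)
        fun x hx ↦ ⟨⟨x, hsub hx⟩, rfl⟩,
      ← Submodule.map_span] at hka
    obtain ⟨y, hy, hya⟩ := hka
    rwa [← (P n).subtype_injective (hya.trans (map_smul (P n).subtype k a).symm)]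
  have htf : ∀ n, Module.IsTorsionFree ℤ (A ⧸ P n) := by
    intro n
    refine Module.IsTorsionFree.of_smul_eq_zero fun k x h ↦ ?_
    obtain ⟨a, rfl⟩ := (P n).mkQ_surjective x
    by_contra! hkx
    apply hkx.2
    rw [← map_smul, Submodule.mkQ_apply, Submodule.Quotient.mk_eq_zero, hmem] at h
    obtain ⟨l, hl, hla⟩ := h
    rw [Submodule.mkQ_apply, Submodule.Quotient.mk_eq_zero, hmem]
    exact ⟨l * k, mul_ne_zero hl hkx.1, by rwa [mul_smul]⟩
  have hC : ∀ n, ∃ C, Disjoint (P n) C ∧ P n ⊔ C = P (n + 1) := fun n ↦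
    Submodule.exists_disjoint_sup_eq_of_isTorsionFree_quotient (hP n.le_succ) (hfg _)
  choose C hd hsup using hC
  have hCP : ∀ n, C n ≤ P (n + 1) := fun n ↦ hsup n ▸ le_sup_right
  have hfree : ∀ n, Module.Free ℤ (C n) := fun n ↦ by
    have : Module.Finite ℤ (P (n + 1)) := Module.Finite.iff_fg.2 (hfg _)
    have : Module.Finite ℤ (C n) :=
      .of_injective (Submodule.inclusion (hCP n)) (Submodule.inclusion_injective _)
    infer_instance
  refine Module.Free.of_iSupIndep (iSupIndep_of_disjoint_of_le_succ hP hCP hd) ?_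
  have hPC : ∀ n, P n ≤ iSup C := by
    intro n
    induction n with
    | zero =>
      intro x hx
      obtain ⟨k, hk, hkx⟩ := (hmem 0 x).1 hx
      have : x = 0 := by simpa [F, hk] using hkx
      simp [this]
    | succ n ih => exact hsup n ▸ sup_le ih (le_iSup C n)
  rw [eq_top_iff]
  rintro x -
  obtain ⟨n, rfl⟩ := he x
  exact hPC (n + 1) (hFP _ (Submodule.subset_span ⟨n, Nat.lt_succ_self n, rfl⟩))

/-- every Whitehead group is ℵ₁-free. -/
theorem stmt8 (G : Type u) [AddCommGroup G] (hW : IsWhitehead G) :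
    IsKappaFree (Cardinal.aleph 1) G := by
  intro H hH
  have : Countable H := Cardinal.mk_le_aleph0_iff.1 (Cardinal.lt_aleph_one_iff.1 hH)
  exact (hW.liftsCharacters.of_injective H.subtype H.subtype_injective).free
end
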